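/- arXiv:1010.4313 — 3 statements merged into one kernel-verified Lean document; each statement's English description precedes it below -/
import Mathlib

section
/- Lemma 5.1 (Exponential equivalence). Under the setup and Assumption 4.1 (with a_n := π(E_{[ψ^←(n)]}) γ(n) ψ^←(n)/c_n and b_n := π(E_{[ψ^←(n)]}) ψ^←(n)/c_n², where either c_n = 1, or c_n → ∞ with b_n → ∞; in particular a_n / b_n → ∞), for every ε > 0, lim_{n→∞} b_n^{−1} log P[ ‖Y_n − Ỹ_n‖_∞ > ε ] = −∞, i.e. the laws of the step processes Y_n and of the polygonal processes Ỹ_n are exponentially equivalent in the sup norm. -/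
open MeasureTheory ProbabilityTheory Filter Set Topology
open scoped ENNReal BoundedContinuousFunction

noncomputable section

/-- The truncation `⟦z⟧ = z/(|z| ∨ 1)`. -/
def trunc (z : ℝ) : ℝ := z / max |z| 1

/-- The cumulant `g(λ) = ∫ (e^{λ z} - 1 - λ ⟦z⟧) ρ(dz)` of a Lévy measure `ρ`. -/
def cumulant (ρ : Measure ℝ) (l : ℝ) : ℝ := ∫ z, (Real.exp (l * z) - 1 - l * trunc z) ∂ρ

/-- `ḡ(t) = min { |s| : g(s) = t }`. -/
def gbar (ρ : Measure ℝ) (t : ℝ) : ℝ := sInf {y : ℝ | ∃ s : ℝ, |s| = y ∧ cumulant ρ s = t}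

/-- The integrability functional `Φ_M` for local characteristics `(0, ρ, 0)`. -/
def PhiM (ρ : Measure ℝ) (x : ℝ) : ℝ≥0∞ :=
  (∫⁻ y, ENNReal.ofReal (trunc (x * y) ^ 2) ∂ρ) +
    ENNReal.ofReal |∫ y, (trunc (x * y) - x * trunc y) ∂ρ|

/-- Probability that the next `k` steps of a Markov chain with kernel `κ` started at `x`
lie in `A 0, …, A (k-1)` respectively. -/
def stepProb {E : Type*} [MeasurableSpace E] (κ : Kernel E E) :
    (ℕ → Set E) → ℕ → E → ℝ≥0∞
  | _, 0, _ => 1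
  | A, k + 1, x => ∫⁻ y in A 0, stepProb κ (fun i => A (i + 1)) k y ∂(κ x)

/-- First hitting time (after time `0`) of the set `a`, `⊤` if the set is never hit. -/
def hitT {E : Type*} (a : Set E) (ω : ℕ → E) : ℕ∞ :=
  ⨅ (n : ℕ) (_ : 0 < n ∧ ω n ∈ a), (n : ℕ∞)

/-- The real value of the hitting time (junk value `0` if infinite). -/
def hitTr {E : Type*} (a : Set E) (ω : ℕ → E) : ℝ := (hitT a ω).toNat

/-- The law of the Markov chain with initial distribution `π(· ∩ E_n)/π(E_n)`. -/
def Ppart {E : Type*} [MeasurableSpace E] (π : Measure E) (Epart : ℕ → Set E)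
    (Pm : E → Measure (ℕ → E)) (n : ℕ) : Measure (ℕ → E) :=
  Measure.bind ((π (Epart n))⁻¹ • π.restrict (Epart n)) Pm

/-- Regular variation with index `idx` at infinity. -/
def RegVary (h : ℝ → ℝ) (idx : ℝ) : Prop :=
  ∀ x : ℝ, 0 < x → Tendsto (fun t : ℝ => h (t * x) / h t) atTop (nhds (x ^ idx))

/-- Generalized inverse `ψ^←(x) = inf{y ≥ 1 : ψ(y) ≥ x}`. -/
def geninv (ψf : ℝ → ℝ) (x : ℝ) : ℝ := sInf {y : ℝ | 1 ≤ y ∧ x ≤ ψf y}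

/-- Large deviation principle with speed `b` and rate function `I`. -/
def IsLDP {X : Type*} [TopologicalSpace X] [MeasurableSpace X]
    (μ : ℕ → Measure X) (b : ℕ → ℝ) (I : X → ℝ≥0∞) : Prop :=
  ∀ A : Set X, MeasurableSet A →
    (-((⨅ x ∈ interior A, I x : ℝ≥0∞) : EReal)
        ≤ liminf (fun n => (((b n)⁻¹ : ℝ) : EReal) * ENNReal.log (μ n A)) atTop) ∧
      limsup (fun n => (((b n)⁻¹ : ℝ) : EReal) * ENNReal.log (μ n A)) atTop
        ≤ -((⨅ x ∈ closure A, I x : ℝ≥0∞) : EReal)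

/-- Good rate function: lower semicontinuous (nonnegativity is built into `ℝ≥0∞`)
with compact level sets. -/
def IsGoodRate {X : Type*} [TopologicalSpace X] (I : X → ℝ≥0∞) : Prop :=
  LowerSemicontinuous I ∧ ∀ c : ℝ≥0∞, c ≠ ⊤ → IsCompact {x | I x ≤ c}

/-- The space of real-valued functions on `[0,1]`, with the topology of uniform
convergence (the sup-norm topology). -/
abbrev Dsp : Type := UniformFun (Set.Icc (0 : ℝ) 1) ℝ

instance : MeasurableSpace Dsp := borel Dsp

/-- `φ` is a density of the absolutely continuous function `ξ` vanishing at `0`. -/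
def ACDensity (ξ : Dsp) (φ : ℝ → ℝ) : Prop :=
  IntegrableOn φ (Set.Icc (0 : ℝ) 1) volume ∧
    ∀ t : Set.Icc (0 : ℝ) 1, UniformFun.toFun ξ t = ∫ s in (0 : ℝ)..(t : ℝ), φ s

/-- The inverse subordinator `U(t) = inf{x ≥ 0 : S_α(x) ≥ t}`, with `U(t) = 0` for `t < 0`. -/
def invSub {Ω' : Type*} (Sa : ℝ → Ω' → ℝ) (t : ℝ) (ω : Ω') : ℝ :=
  if t < 0 then 0 else sInf {x : ℝ | 0 ≤ x ∧ t ≤ Sa x ω}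

open scoped Classical in
/-- The Lebesgue–Stieltjes measure `U(dt)` of the (monotone) path `t ↦ U(t)(ω)`. -/
def Umeasure {Ω' : Type*} (Sa : ℝ → Ω' → ℝ) (ω : Ω') : Measure ℝ :=
  if h : Monotone fun t => invSub Sa t ω then h.stieltjesFunction.measure else 0

/-- The limiting cumulant functional
`Λ(ψ) = ∫_0^∞ r^ζ E[ 1{r^β V ≤ 1} g̃( c_f ∫_0^{1 - r^β V} ψ(t) U(dt) ) ] dr`. -/
def LamFun (gt : ℝ → ℝ) (ζ β cf : ℝ) {Ω' : Type*} [MeasurableSpace Ω'] (P' : Measure Ω')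
    (Sa : ℝ → Ω' → ℝ) (V : Ω' → ℝ) (ψ : ℝ → ℝ) : ℝ :=
  ∫ r in Set.Ioi (0 : ℝ), r ^ ζ *
    ∫ ω, Set.indicator {ω' : Ω' | r ^ β * V ω' ≤ 1}
      (fun ω' => gt (cf * ∫ t in Set.Ioc (0 : ℝ) (1 - r ^ β * V ω'), ψ t ∂(Umeasure Sa ω')))
      ω ∂P'

/-- The rate function on densities,
`Λ*(φ) = sup_{ψ ∈ L^∞[0,1]} { ∫_0^1 ψ φ - Λ(ψ) }`. -/
def LamStar (gt : ℝ → ℝ) (ζ β cf : ℝ) {Ω' : Type*} [MeasurableSpace Ω'] (P' : Measure Ω')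
    (Sa : ℝ → Ω' → ℝ) (V : Ω' → ℝ) (φ : ℝ → ℝ) : ℝ≥0∞ :=
  ⨆ (ψ : ℝ → ℝ) (_ : Measurable ψ ∧ ∃ C : ℝ, ∀ t, |ψ t| ≤ C),
    ENNReal.ofReal ((∫ t in Set.Icc (0 : ℝ) 1, ψ t * φ t) - LamFun gt ζ β cf P' Sa V ψ)

/-- The path-space rate function: `Λ*(ξ')` for absolutely continuous `ξ` with `ξ(0) = 0`,
and `∞` otherwise. -/
def rateH (gt : ℝ → ℝ) (ζ β cf : ℝ) {Ω' : Type*} [MeasurableSpace Ω'] (P' : Measure Ω')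
    (Sa : ℝ → Ω' → ℝ) (V : Ω' → ℝ) (ξ : Dsp) : ℝ≥0∞ :=
  ⨅ (φ : ℝ → ℝ) (_ : ACDensity ξ φ), LamStar gt ζ β cf P' Sa V φ

/-- The normalized partial sum (step) process `Y_n`, as an element of `Dsp`. -/
def Yproc {Ω : Type*} (X : ℤ → Ω → ℝ) (aseq : ℕ → ℝ) (n : ℕ) (ω : Ω) : Dsp :=
  UniformFun.ofFun fun t => (aseq n)⁻¹ * ∑ i ∈ Finset.Icc 1 ⌊(n : ℝ) * (t : ℝ)⌋₊, X (i : ℤ) ω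

/-- The polygonal (piecewise linear interpolation) process `Ỹ_n`. -/
def Ytil {Ω : Type*} (X : ℤ → Ω → ℝ) (aseq : ℕ → ℝ) (n : ℕ) (ω : Ω) : Dsp :=
  UniformFun.ofFun fun t => (aseq n)⁻¹ *
    ((∑ i ∈ Finset.Icc 1 ⌊(n : ℝ) * (t : ℝ)⌋₊, X (i : ℤ) ω) +
      ((n : ℝ) * (t : ℝ) - ⌊(n : ℝ) * (t : ℝ)⌋₊) * X ((⌊(n : ℝ) * (t : ℝ)⌋₊ : ℤ) + 1) ω)

lemma sigmaFinite_of_lintegral_trunc_sq {ρ : Measure ℝ} (hρ0 : ρ {0} = 0)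
    (hρ2 : (∫⁻ z, ENNReal.ofReal (trunc z ^ 2) ∂ρ) ≠ ⊤) : SigmaFinite ρ := by
  have hmeas : Measurable fun z : ℝ => ENNReal.ofReal (trunc z ^ 2) := by
    unfold trunc; fun_prop
  have hpos : ∀ᵐ z ∂ρ, ENNReal.ofReal (trunc z ^ 2) ≠ 0 := by
    have h0 : ∀ᵐ z ∂ρ, z ≠ 0 := by simpa [ae_iff] using hρ0
    filter_upwards [h0] with z hz
    have hz' : trunc z ≠ 0 := div_ne_zero hz (by positivity)
    exact (ENNReal.ofReal_pos.2 (by positivity)).ne'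
  have hfin : IsFiniteMeasure (ρ.withDensity fun z => ENNReal.ofReal (trunc z ^ 2)) :=
    isFiniteMeasure_withDensity hρ2
  rw [← withDensity_inv_same hmeas hpos (ae_of_all _ fun _ => ENNReal.ofReal_ne_top)]
  refine SigmaFinite.withDensity_of_ne_top ?_
  rw [ae_withDensity_iff hmeas]
  exact ae_of_all _ fun z hz => by simpa using hz

lemma measurable_cumulant (ρ : Measure ℝ) [SFinite ρ] : Measurable (cumulant ρ) := by
  refine StronglyMeasurable.measurable ?_
  unfold cumulant
  refine StronglyMeasurable.integral_prod_right
    (f := fun l z : ℝ => Real.exp (l * z) - 1 - l * trunc z) ?_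
  refine Measurable.stronglyMeasurable ?_
  unfold Function.uncurry trunc
  fun_prop

/-- A positive sequence whose halving ratio is eventually at most `2` decays at most like `1/m`. -/
lemma exists_pos_le_mul_of_le_two_mul_half {w : ℕ → ℝ} (hw : ∀ m, 0 < w m)
    (h : ∀ᶠ m in atTop, w (m / 2) ≤ 2 * w m) :
    ∃ c > 0, ∀ m : ℕ, 1 ≤ m → c ≤ w m * m := by
  obtain ⟨M, hM⟩ := eventually_atTop.1 h
  obtain ⟨c, hc, hcM⟩ : ∃ c > 0, ∀ m ∈ Finset.Icc 1 (M + 1), c ≤ w m * m := by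
    obtain ⟨x, hx, hmin⟩ := Finset.exists_min_image (Finset.Icc 1 (M + 1)) (fun m => w m * m)
      ⟨1, by simp⟩
    have hx1 : (0 : ℝ) < x := by
      exact_mod_cast (Finset.mem_Icc.1 hx).1
    exact ⟨_, mul_pos (hw x) hx1, hmin⟩
  refine ⟨c, hc, fun m => ?_⟩
  induction m using Nat.strong_induction_on with
  | _ m ih =>
    intro hm
    by_cases hmM : m ≤ M + 1
    · exact hcM m (Finset.mem_Icc.2 ⟨hm, hmM⟩)
    · have ih' := ih (m / 2) (by omega) (by omega)
      have h2 := hM m (by omega)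
      have h3 : ((m / 2 : ℕ) : ℝ) ≤ m / 2 := Nat.cast_div_le
      calc c ≤ w (m / 2) * (m / 2 : ℕ) := ih'
        _ ≤ 2 * w m * (m / 2) := by
          have := hw m
          gcongr
        _ = w m * m := by ring

lemma RegVary.eventually_ne_zero {h : ℝ → ℝ} {idx : ℝ} (hRV : RegVary h idx) :
    ∀ᶠ t in atTop, h t ≠ 0 := by
  filter_upwards [(hRV 1 one_pos).eventually_ne (by simp : (1 : ℝ) ^ idx ≠ 0)] with t ht h0
  exact ht (by simp [h0])

lemma RegVary.exists_ge_of_monotone {h : ℝ → ℝ} {idx : ℝ} (hidx : 0 < idx)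
    (hRV : RegVary h idx) (hmono : Monotone h) (x : ℝ) : ∃ y, 1 ≤ y ∧ x ≤ h y := by
  by_contra! hx
  have hlim : Tendsto h atTop (𝓝 (⨆ t, h t)) := by
    refine tendsto_atTop_ciSup hmono ⟨x, ?_⟩
    rintro _ ⟨t, rfl⟩
    exact (hmono (le_max_right 1 t)).trans (hx _ (le_max_left 1 t)).le
  have h2 : Tendsto (fun t : ℝ => h (t * 2)) atTop (𝓝 (⨆ t, h t)) :=
    hlim.comp (tendsto_id.atTop_mul_const two_pos)
  have hlt : (1 : ℝ) < 2 ^ idx := Real.one_lt_rpow one_lt_two hidx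
  have hR := hRV 2 two_pos
  have hle : ∀ᶠ t in atTop, h t ≤ h (t * 2) := by
    filter_upwards [eventually_ge_atTop 0] with t ht
    exact hmono (by linarith)
  have hL : (⨆ t, h t) = 0 := by
    by_contra hne
    have := tendsto_nhds_unique (h2.div hlim hne) hR
    rw [div_self hne] at this
    linarith
  obtain ⟨t, ht1, ht2, ht3⟩ :=
    ((hR.eventually (lt_mem_nhds hlt)).and (hle.and hRV.eventually_ne_zero)).exists
  have hneg : ∀ s, h s ≤ 0 := fun s => hL ▸ hmono.ge_of_tendsto hlim s
  have htneg : h t < 0 := lt_of_le_of_ne (hneg t) ht3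
  rw [lt_div_iff_of_neg htneg] at ht1
  linarith

/-- An eventually positive monotone regularly varying function of positive index grows at least
like a positive power. -/
lemma RegVary.exists_rpow_le {h : ℝ → ℝ} {idx t₀ : ℝ} (hidx : 0 < idx) (hRV : RegVary h idx)
    (hpos : ∀ t ≥ t₀, 0 < h t) (hmono : MonotoneOn h (Ici t₀)) :
    ∃ c > 0, ∀ᶠ t in atTop, c * t ^ (idx / 2) ≤ h t := by
  have hlt : (2 : ℝ) ^ (idx / 2) < 2 ^ idx :=
    Real.rpow_lt_rpow_of_exponent_lt one_lt_two (by linarith)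
  obtain ⟨t₁, ht₁⟩ := eventually_atTop.1 ((hRV 2 two_pos).eventually (lt_mem_nhds hlt))
  set T := max (max t₀ t₁) 1 with hT
  have hT0 : t₀ ≤ T := (le_max_left _ _).trans (le_max_left _ _)
  have hT1 : t₁ ≤ T := (le_max_right _ _).trans (le_max_left _ _)
  have hTpos : 0 < T := lt_of_lt_of_le one_pos (le_max_right _ _)
  have hhT := hpos T hT0
  have key : ∀ k : ℕ, ∀ t, T ≤ t → t ≤ 2 ^ (k + 1) * T →
      h T / (2 * T) ^ (idx / 2) * t ^ (idx / 2) ≤ h t := by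
    intro k
    induction k with
    | zero =>
      intro t h1 h2
      have ht : 0 < t := hTpos.trans_le h1
      calc h T / (2 * T) ^ (idx / 2) * t ^ (idx / 2)
          ≤ h T / (2 * T) ^ (idx / 2) * (2 * T) ^ (idx / 2) := by
            gcongr
            simpa using h2
        _ = h T := div_mul_cancel₀ _ (by positivity)
        _ ≤ h t := hmono hT0 (hT0.trans h1) h1
    | succ k ih =>
      intro t h1 h2
      by_cases htk : t ≤ 2 ^ (k + 1) * T
      · exact ih t h1 htk
      · push Not at htk
        have h2k : (1 : ℝ) ≤ 2 ^ k := one_le_pow₀ one_le_two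
        have hTt : T ≤ t / 2 := by
          rw [pow_succ] at htk
          nlinarith
        have hih := ih (t / 2) hTt (by rw [pow_succ] at h2; linarith)
        have hr := ht₁ (t / 2) (hT1.trans hTt)
        rw [lt_div_iff₀ (hpos _ (hT0.trans hTt)), div_mul_cancel₀ _ two_ne_zero] at hr
        have ht : 0 < t := hTpos.trans_le h1
        refine le_trans ?_ hr.le
        calc h T / (2 * T) ^ (idx / 2) * t ^ (idx / 2)
            = 2 ^ (idx / 2) * (h T / (2 * T) ^ (idx / 2) * (t / 2) ^ (idx / 2)) := by
              rw [Real.div_rpow ht.le two_pos.le]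
              field_simp
          _ ≤ 2 ^ (idx / 2) * h (t / 2) := by gcongr
  refine ⟨h T / (2 * T) ^ (idx / 2), by positivity, ?_⟩
  filter_upwards [eventually_ge_atTop T] with t ht
  obtain ⟨k, hk⟩ := pow_unbounded_of_one_lt (t / T) one_lt_two
  refine key k t ht ?_
  rw [div_lt_iff₀ hTpos] at hk
  rw [pow_succ]
  nlinarith [pow_pos (two_pos (α := ℝ)) k]

lemma tendsto_log_sub_mul_atBot {G : ℕ → ℝ} {s c : ℝ} (hs : 0 < s) (hc : 0 < c)
    (hG : ∀ᶠ n : ℕ in atTop, c * (n : ℝ) ^ s ≤ G n) (A B : ℝ) {ε : ℝ} (hε : 0 < ε) :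
    Tendsto (fun n : ℕ => A * Real.log n + B - ε * G n) atTop atBot := by
  have hreal : Tendsto (fun t : ℝ => B + (A * Real.log t - ε * c * t ^ s)) atTop atBot := by
    refine tendsto_atBot_add_const_left _ _ ?_
    have hlo : (fun t : ℝ => A * Real.log t) =o[atTop] fun t => t ^ s :=
      (isLittleO_log_rpow_atTop hs).const_mul_left A
    have hb : ∀ᶠ t : ℝ in atTop, A * Real.log t - ε * c * t ^ s ≤ -(ε * c / 2 * t ^ s) := by
      filter_upwards [hlo.bound (c := ε * c / 2) (by positivity), eventually_ge_atTop 0]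
        with t ht ht0
      rw [Real.norm_eq_abs, Real.norm_eq_abs, abs_of_nonneg (Real.rpow_nonneg ht0 s)] at ht
      have := le_abs_self (A * Real.log t)
      linarith
    refine tendsto_atBot_mono' _ hb (tendsto_neg_atTop_atBot.comp ?_)
    exact (tendsto_rpow_atTop hs).const_mul_atTop (by positivity)
  refine tendsto_atBot_mono' _ ?_ (hreal.comp tendsto_natCast_atTop_atTop)
  filter_upwards [hG] with n hn
  simp only [Function.comp]
  nlinarith

lemma EReal.tendsto_mul_log_bot {p : ℕ → ℝ≥0∞} {b u v : ℕ → ℝ} (hb : ∀ᶠ n in atTop, 0 < b n)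
    (hp : ∀ᶠ n in atTop, p n ≤ ENNReal.ofReal (Real.exp (u n)))
    (huv : ∀ᶠ n in atTop, (b n)⁻¹ * u n ≤ v n) (hv : Tendsto v atTop atBot) :
    Tendsto (fun n => (((b n)⁻¹ : ℝ) : EReal) * ENNReal.log (p n)) atTop (𝓝 (⊥ : EReal)) := by
  rw [EReal.tendsto_nhds_bot_iff_real]
  intro x
  filter_upwards [hb, hp, huv, hv.eventually_lt_atBot x] with n h1 h2 h3 h4
  have hlog : ENNReal.log (p n) ≤ (u n : EReal) := by
    refine (ENNReal.log_le_log h2).trans_eq ?_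
    rw [ENNReal.log_ofReal_of_pos (Real.exp_pos _), Real.log_exp]
  calc (((b n)⁻¹ : ℝ) : EReal) * ENNReal.log (p n)
      ≤ (((b n)⁻¹ : ℝ) : EReal) * (u n : EReal) := by
        refine mul_le_mul_of_nonneg_left hlog ?_
        exact_mod_cast (inv_pos.2 h1).le
    _ = (((b n)⁻¹ * u n : ℝ) : EReal) := by rw [EReal.coe_mul]
    _ < x := by exact_mod_cast h3.trans_lt h4

lemma measure_lt_abs_le_of_integrable_exp {Ω : Type*} [MeasurableSpace Ω] {P : Measure Ω}
    [IsProbabilityMeasure P] {X : Ω → ℝ} (h₁ : Integrable (fun ω => Real.exp (X ω)) P)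
    (h₂ : Integrable (fun ω => Real.exp (-X ω)) P) (x : ℝ) :
    P {ω | x < |X ω|} ≤ ENNReal.ofReal
      (((∫ ω, Real.exp (X ω) ∂P) + ∫ ω, Real.exp (-X ω) ∂P) * Real.exp (-x)) := by
  have hint := h₁.add h₂
  have hnn : ∀ ω, 0 ≤ Real.exp (X ω) + Real.exp (-X ω) := fun ω => by positivity
  have hM := mul_meas_ge_le_integral_of_nonneg (ae_of_all _ hnn) hint (Real.exp x)
  have hsub : P.real {ω | x < |X ω|}
      ≤ P.real {ω | Real.exp x ≤ Real.exp (X ω) + Real.exp (-X ω)} := by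
    refine measureReal_mono fun ω (hω : x < |X ω|) => ?_
    change Real.exp x ≤ _
    rcases lt_abs.1 hω with h | h
    · linarith [Real.exp_le_exp.2 h.le, Real.exp_pos (-X ω)]
    · linarith [Real.exp_le_exp.2 h.le, Real.exp_pos (X ω)]
  rw [← ofReal_measureReal]
  refine ENNReal.ofReal_le_ofReal ?_
  rw [← integral_add h₁ h₂, Real.exp_neg, ← div_eq_mul_inv, le_div_iff₀ (Real.exp_pos x)]
  refine le_trans ?_ hM
  rw [mul_comm]
  exact mul_le_mul_of_nonneg_left hsub (Real.exp_pos x).le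

lemma setOf_lt_abs_Yproc_sub_Ytil_subset {Ω : Type*} (X : ℤ → Ω → ℝ) {aseq : ℕ → ℝ} {n : ℕ}
    (ha : 0 < aseq n) (ε : ℝ) :
    {ω | ∃ t : Set.Icc (0:ℝ) 1, ε < |UniformFun.toFun (Yproc X aseq n ω) t
        - UniformFun.toFun (Ytil X aseq n ω) t|}
      ⊆ ⋃ i ∈ Finset.range (n + 1), {ω | ε * aseq n < |X ((i : ℤ) + 1) ω|} := by
  rintro ω ⟨t, ht⟩
  have hnt : (0 : ℝ) ≤ n * (t : ℝ) := mul_nonneg n.cast_nonneg t.2.1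
  simp only [mem_iUnion, Finset.mem_range, mem_ofPred_eq, exists_prop]
  refine ⟨⌊(n : ℝ) * (t : ℝ)⌋₊, ?_, ?_⟩
  · rw [Nat.lt_succ_iff]
    refine Nat.floor_le_of_le ?_
    exact mul_le_of_le_one_right n.cast_nonneg t.2.2
  · have h1 := Nat.floor_le hnt
    have h2 := Nat.lt_floor_add_one ((n : ℝ) * (t : ℝ))
    simp only [Yproc, Ytil, UniformFun.toFun_ofFun] at ht
    rw [← mul_sub, sub_add_cancel_left, abs_mul, abs_neg, abs_mul, abs_of_pos (inv_pos.2 ha),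
      abs_of_nonneg (sub_nonneg.2 h1), inv_mul_eq_div, lt_div_iff₀ ha] at ht
    refine ht.trans_le (mul_le_of_le_one_left (abs_nonneg _) ?_)
    linarith

/-- **Lemma 5.1 (Exponential equivalence of the step and polygonal processes).** -/
theorem exponential_equivalence
    /- the state space and the Markov kernel -/
    {E : Type*} [MeasurableSpace E] (κ : Kernel E E) [IsMarkovKernel κ]
    (π : Measure E) [SigmaFinite π]
    (hinv : Measure.bind π (fun x => κ x) = π)
    (hnull : π Set.univ = ⊤)
    /- the laws `P_x` of the chain started at `x` -/
    (Pm : E → Measure (ℕ → E)) (hPmProb : ∀ x, IsProbabilityMeasure (Pm x))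
    (hstart : ∀ x, Pm x {ω | ω 0 = x} = 1)
    (hmarkov : ∀ (x : E) (k : ℕ) (A : ℕ → Set E), (∀ i, MeasurableSet (A i)) →
      Pm x {ω | ∀ i < k, ω (i + 1) ∈ A i} = stepProb κ A k x)
    /- irreducibility and Harris recurrence -/
    (hHarris : ∀ A : Set E, MeasurableSet A → 0 < π A → ∀ x,
      Pm x {ω | ∀ N : ℕ, ∃ n ≥ N, ω n ∈ A} = 1)
    /- the atom -/
    (a : Set E) (hameas : MeasurableSet a) (hπa : 0 < π a) (hπafin : π a ≠ ⊤)
    (hatom : ∀ x ∈ a, ∀ y ∈ a, κ x = κ y) (xa : E) (hxa : xa ∈ a)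
    /- `γ(x) = (π(a) P_a[T > x])⁻¹` is regularly varying of index `α ∈ (0,1)` -/
    (γ : ℝ → ℝ) (α : ℝ) (hα0 : 0 < α) (hα1 : α < 1)
    (hγdef : ∀ x : ℝ, γ x =
      ((π a).toReal * (Pm xa {ω | ∀ n : ℕ, 0 < n → (n : ℝ) ≤ x → ω n ∉ a}).toReal)⁻¹)
    (hγRV : RegVary γ α)
    /- the partition `(E_n)` of `E` -/
    (Epart : ℕ → Set E) (hEmeas : ∀ n, MeasurableSet (Epart n))
    (hEdisj : Pairwise fun i j => Disjoint (Epart i) (Epart j))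
    (hEcover : (⋃ n, Epart n) = Set.univ)
    (hEfin : ∀ n, π (Epart n) ≠ ⊤) (hEpos : ∀ n, 0 < π (Epart n))
    /- `ψ ∈ RV_β` monotone, and `P_{π_n}[T/ψ(n) ∈ ·] ⇒ Q` -/
    (ψf : ℝ → ℝ) (β : ℝ) (hβ : 0 < β) (hψmono : Monotone ψf) (hψRV : RegVary ψf β)
    (Q : Measure ℝ) [IsProbabilityMeasure Q]
    (hQweak : ∀ F : ℝ →ᵇ ℝ, Tendsto
      (fun n : ℕ => ∫ ω, F (hitTr a ω / ψf n) ∂(Ppart π Epart Pm n)) atTop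
      (nhds (∫ x, F x ∂Q)))
    /- `π(E_{[rn]})/π(E_n) → r^ζ` -/
    (ζ : ℝ) (hζ : -1 < ζ)
    (hπreg : ∀ r : ℝ, 0 < r → Tendsto
      (fun n : ℕ => (π (Epart ⌊r * (n : ℝ)⌋₊)).toReal / (π (Epart n)).toReal) atTop
      (nhds (r ^ ζ)))
    /- condition (eq:Qassmp) -/
    (hQasmp : ∃ ε' > (0:ℝ), ∃ c > (0:ℝ), ∃ N : ℝ, 1 < N ∧ ∃ k > (0:ℝ), ∃ ε > (0:ℝ),
      ∀ r : ℝ, 1 ≤ r → ∀ n : ℕ, N * r ≤ (n : ℝ) →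
        (Ppart π Epart Pm n {ω | hitTr a ω / ψf n ≤ c * r ^ (-β + ε')}).toReal
          < k * r ^ (-ζ - 1 - ε))
    /- the Lévy measure `ρ` with exponential moments -/
    (ρ : Measure ℝ) (hρ0 : ρ {0} = 0)
    (hρ2 : (∫⁻ z, ENNReal.ofReal (trunc z ^ 2) ∂ρ) ≠ ⊤)
    (hρexp : ∀ l : ℝ, (∫⁻ z in {z : ℝ | 1 < |z|}, ENNReal.ofReal (Real.exp (l * z)) ∂ρ) ≠ ⊤)
    /- the path-space control measure `m` -/
    (m : Measure (ℤ → E))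
    (hm : ∀ (n : ℤ) (k : ℕ) (A : ℕ → Set E), (∀ i, MeasurableSet (A i)) →
      m {s | ∀ i ≤ k, s (n + (i : ℤ)) ∈ A i}
        = ∫⁻ x in A 0, stepProb κ (fun i => A (i + 1)) k x ∂π)
    /- the function `f` -/
    (f : E → ℝ) (hfmeas : Measurable f) (hfint : Integrable f π)
    (hcf : (∫ x, f x ∂π) ≠ 0)
    (hfM : (∫⁻ s, PhiM ρ (f (s 0)) ∂m) ≠ ⊤)
    /- condition (eq:fassmp) -/
    (hfassmp : ∀ l : ℝ, 0 < l → ∃ k > (0:ℝ), ∃ N : ℝ, 1 < N ∧ ∃ ε > (0:ℝ),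
      ∀ r : ℝ, 1 ≤ r → ∀ n : ℕ, N * r ≤ (n : ℝ) →
        (∫ ω, cumulant ρ
            (l * ∑ i ∈ Finset.Icc 1 ((hitT a ω ⊓ ((⌊ψf ((n : ℝ) / r)⌋₊ : ℕ∞))).toNat),
              |f (ω i)|) ∂(Ppart π Epart Pm n))
          ≤ k * r ^ (-ζ - 1 - ε))
    /- the stationary infinitely divisible process `X_n = ∫_S f(s_n) M(ds)` -/
    {Ω : Type*} [MeasurableSpace Ω] (P : Measure Ω) [IsProbabilityMeasure P]
    (X : ℤ → Ω → ℝ) (hXmeas : ∀ n, Measurable (X n))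
    (hXchar : ∀ (J : Finset ℤ) (c : ℤ → ℝ),
      (∫ ω, Real.exp (∑ n ∈ J, c n * X n ω) ∂P)
        = Real.exp (∫ s, cumulant ρ (∑ n ∈ J, c n * f (s n)) ∂m))
    (hXmean : (∫ ω, X 0 ω ∂P) = 0)
    (σ2 : ℝ) (hσ2 : σ2 = ∫ ω, (X 0 ω) ^ 2 ∂P)
    /- Assumption 4.1 -/
    (hassmp : ∃ δ : ℝ, 1 ≤ δ ∧ δ < (1 - α)⁻¹ ∧
      (∃ k₀ > (0:ℝ),
        (∫⁻ t in Set.Ioi (0:ℝ), ENNReal.ofReal (Real.exp (-k₀ * gbar ρ t ^ δ))) ≠ ⊤) ∧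
      (∃ l > (0:ℝ), ∃ C : ℝ≥0∞, C ≠ ⊤ ∧ ∀ x : E,
        (∫⁻ ω, ENNReal.ofReal
            (Real.exp ((l * ∑ i ∈ Finset.Icc 1 (hitT a ω).toNat, |f (ω i)|) ^ δ))
          ∂(Pm x)) ≤ C))
    /- the normalization: `c_n = 1` (LDP case) or `c_n → ∞` with `b_n → ∞` (MDP case) -/
    (cseq : ℕ → ℝ) (aseq bseq : ℕ → ℝ)
    (haseq : ∀ n : ℕ, aseq n =
      (π (Epart ⌊geninv ψf (n : ℝ)⌋₊)).toReal * γ (n : ℝ) * geninv ψf (n : ℝ) / cseq n)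
    (hbseq : ∀ n : ℕ, bseq n =
      (π (Epart ⌊geninv ψf (n : ℝ)⌋₊)).toReal * geninv ψf (n : ℝ) / (cseq n) ^ 2)
    (hcase : (∀ n, cseq n = 1) ∨
      (Tendsto cseq atTop atTop ∧ Tendsto bseq atTop atTop)) :
    ∀ ε : ℝ, 0 < ε →
      Tendsto (fun n => (((bseq n)⁻¹ : ℝ) : EReal) *
          ENNReal.log (P {ω | ∃ t : Set.Icc (0:ℝ) 1,
            ε < |UniformFun.toFun (Yproc X aseq n ω) t
                  - UniformFun.toFun (Ytil X aseq n ω) t|}))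
        atTop (nhds (⊥ : EReal)) := by
  obtain ⟨t₀, hγpos, hγmono⟩ : ∃ t₀ : ℝ, (∀ t ≥ t₀, 0 < γ t) ∧ MonotoneOn γ (Ici t₀) := by
    obtain ⟨t₀, ht₀⟩ := eventually_atTop.1 hγRV.eventually_ne_zero
    have hpos : ∀ t ≥ t₀, 0 < γ t := fun t ht =>
      lt_of_le_of_ne (by rw [hγdef]; positivity) (ht₀ t ht).symm
    refine ⟨t₀, hpos, fun x hx y hy hxy => ?_⟩
    have hy' := hpos y hy
    have := hPmProb xa
    rw [hγdef] at hy' ⊢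
    rw [hγdef y]
    refine inv_anti₀ (inv_pos.1 hy') (mul_le_mul_of_nonneg_left ?_ ENNReal.toReal_nonneg)
    exact measureReal_mono fun ω hω n hn hnx => hω n hn (hnx.trans hxy)
  obtain ⟨cγ, hcγ, hγge⟩ := hγRV.exists_rpow_le hα0 hγpos hγmono
  have hγge' : ∀ᶠ n : ℕ in atTop, cγ * (n : ℝ) ^ (α / 2) ≤ γ n :=
    tendsto_natCast_atTop_atTop.eventually hγge
  have hw : ∀ m, 0 < (π (Epart m)).toReal := fun m =>
    ENNReal.toReal_pos (hEpos m).ne' (hEfin m)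
  obtain ⟨cw, hcw, hwge⟩ : ∃ c > 0, ∀ m : ℕ, 1 ≤ m → c ≤ (π (Epart m)).toReal * m := by
    refine exists_pos_le_mul_of_le_two_mul_half hw ?_
    have hlt : ((2 : ℝ)⁻¹) ^ ζ < 2 := by
      rw [Real.inv_rpow two_pos.le, ← Real.rpow_neg two_pos.le]
      calc (2 : ℝ) ^ (-ζ) < 2 ^ (1 : ℝ) :=
            Real.rpow_lt_rpow_of_exponent_lt one_lt_two (by linarith)
        _ = 2 := Real.rpow_one 2
    filter_upwards [(hπreg 2⁻¹ (by norm_num)).eventually (gt_mem_nhds hlt)] with m hm2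
    rw [div_lt_iff₀ (hw m), inv_mul_eq_div, Nat.floor_div_ofNat, Nat.floor_natCast] at hm2
    exact hm2.le
  have hgen : ∀ x, 1 ≤ geninv ψf x := fun x =>
    le_csInf (hψRV.exists_ge_of_monotone hβ hψmono x) fun y hy => hy.1
  have hbc : ∃ c₀ > 0, ∀ᶠ n in atTop, c₀ ≤ bseq n ∧ 1 ≤ cseq n := by
    rcases hcase with h1 | ⟨hc, hb⟩
    · refine ⟨cw, hcw, Eventually.of_forall fun n => ⟨?_, (h1 n).ge⟩⟩
      have hg := hgen n
      rw [hbseq, h1, one_pow, div_one]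
      refine (hwge _ (Nat.le_floor (by simpa using hg))).trans ?_
      exact mul_le_mul_of_nonneg_left (Nat.floor_le (by linarith)) (hw _).le
    · exact ⟨1, one_pos, (hb.eventually_ge_atTop 1).and (hc.eventually_ge_atTop 1)⟩
  obtain ⟨c₀, hc₀, hbc⟩ := hbc
  have hab : ∀ n, 1 ≤ cseq n → aseq n = bseq n * (γ n * cseq n) := fun n hn => by
    have : cseq n ≠ 0 := by linarith
    rw [haseq, hbseq]
    field_simp
  have := sigmaFinite_of_lintegral_trunc_sq hρ0 hρ2
  have hmap : ∀ n : ℤ, m.map (fun s => s n) = π := fun n => by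
    ext A hA
    rw [Measure.map_apply (measurable_pi_apply n) hA]
    have hA' : m {s | s n ∈ A} = π A := by
      simpa [stepProb] using hm n 0 (fun _ => A) fun _ => hA
    exact hA'
  have hmgf : ∀ (c : ℝ) (n : ℤ), (∫ ω, Real.exp (c * X n ω) ∂P)
      = Real.exp (∫ x, cumulant ρ (c * f x) ∂π) := fun c n => by
    have hX := hXchar {n} fun _ => c
    simp only [Finset.sum_singleton] at hX
    rw [hX, ← hmap n, integral_map (measurable_pi_apply n).aemeasurable]
    exact ((measurable_cumulant ρ).comp (hfmeas.const_mul c)).aestronglyMeasurable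
  have hexp : ∀ (c : ℝ) (n : ℤ), Integrable (fun ω => Real.exp (c * X n ω)) P := fun c n =>
    Integrable.of_integral_ne_zero (by rw [hmgf]; exact (Real.exp_pos _).ne')
  set K : ℝ := Real.exp (∫ x, cumulant ρ (1 * f x) ∂π)
    + Real.exp (∫ x, cumulant ρ (-1 * f x) ∂π) with hK
  have hKpos : 0 < K := by positivity
  have htail : ∀ (n : ℤ) (x : ℝ), P {ω | x < |X n ω|} ≤ ENNReal.ofReal (K * Real.exp (-x)) := by
    intro n x
    have := measure_lt_abs_le_of_integrable_exp (P := P) (X := X n)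
      (by simpa using hexp 1 n) (by simpa using hexp (-1) n) x
    rw [hK, ← hmgf 1 n, ← hmgf (-1) n]
    simpa using this
  intro ε hε
  have hc : ∀ᶠ n : ℕ in atTop, 0 < bseq n ∧ 1 ≤ cseq n ∧ 0 < γ n ∧ c₀ ≤ bseq n ∧ 1 ≤ n := by
    filter_upwards [hbc, tendsto_natCast_atTop_atTop.eventually (eventually_ge_atTop t₀),
      eventually_ge_atTop 1] with n h1 h2 h3
    exact ⟨hc₀.trans_le h1.1, h1.2, hγpos _ h2, h1.1, h3⟩
  refine EReal.tendsto_mul_log_bot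
    (u := fun n => Real.log n + Real.log (2 * K) - ε * aseq n)
    (v := fun n => c₀⁻¹ * Real.log n + c₀⁻¹ * |Real.log (2 * K)| - ε * γ n)
    (hc.mono fun n h => h.1) ?_ ?_
    (tendsto_log_sub_mul_atBot (half_pos hα0) hcγ hγge' _ _ hε)
  · filter_upwards [hc] with n ⟨hb, hc1, hγn, _, hn⟩
    have ha : 0 < aseq n := by
      rw [hab n hc1]
      have : 0 < cseq n := by linarith
      positivity
    have hn0 : (1 : ℝ) ≤ n := by exact_mod_cast hn
    refine (measure_mono (setOf_lt_abs_Yproc_sub_Ytil_subset X ha ε)).trans ?_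
    refine (measure_biUnion_finset_le _ _).trans ?_
    refine (Finset.sum_le_sum fun i _ => htail _ _).trans ?_
    rw [Finset.sum_const, Finset.card_range, ← ENNReal.ofReal_nsmul]
    refine ENNReal.ofReal_le_ofReal ?_
    rw [Real.exp_sub, Real.exp_add, Real.exp_log (by linarith), Real.exp_log (by positivity),
      div_eq_mul_inv, ← Real.exp_neg, nsmul_eq_mul, ← mul_assoc]
    refine mul_le_mul_of_nonneg_right ?_ (Real.exp_pos _).le
    push_cast
    nlinarith
  · filter_upwards [hc] with n ⟨hb, hc1, hγn, hbc₀, hn⟩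
    have hlog : 0 ≤ Real.log n := Real.log_natCast_nonneg n
    have hinv : (bseq n)⁻¹ ≤ c₀⁻¹ := inv_anti₀ hc₀ hbc₀
    have h1 : (bseq n)⁻¹ * (Real.log n + Real.log (2 * K))
        ≤ c₀⁻¹ * (Real.log n + |Real.log (2 * K)|) := by
      have := le_abs_self (Real.log (2 * K))
      have := inv_pos.2 hb
      calc _ ≤ (bseq n)⁻¹ * (Real.log n + |Real.log (2 * K)|) := by gcongr
        _ ≤ _ := by gcongr
    have h2 : (bseq n)⁻¹ * (ε * aseq n) = ε * (γ n * cseq n) := by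
      rw [hab n hc1]
      field_simp
    have h3 : ε * γ n ≤ ε * (γ n * cseq n) := by
      gcongr
      exact le_mul_of_one_le_right hγn.le hc1
    rw [mul_sub, h2]
    linarith
end
end

section
/- Lemma 5.6 (Uniform integrability). Under the setup and Assumption 4.1 (with c_n = 1 in the LDP case, where Assumption 4.1(ii) holds for all λ ∈ ℝ, or c_n → ∞ in the MDP case), for any finite set j = {0 = t_0 < t_1 < ⋯ < t_{|j|} ≤ 1} and any λ_1,…,λ_{|j|} ∈ ℝ there exists K ≥ 1 such that, writing G_n := g( (γ(n) c_n)^{−1} Σ_{i=1}^{|j|} λ_i Σ_{k=[nt_{i−1}]+1}^{[nt_i]} f(Z_k) ), one has sup_{x∈E, n≥K} E_x[ G_n · 1{G_n ≥ N} ] → 0 as N → ∞. -/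
open MeasureTheory ProbabilityTheory Filter Set Topology
open scoped ENNReal BoundedContinuousFunction

noncomputable section

/-! ### Chains: path laws and the one-step decomposition -/

/-- `Pm x` is, for every `x`, the law of the Markov chain with kernel `κ` started at `x`. -/
structure IsChainLaw {E : Type*} [MeasurableSpace E] (κ : Kernel E E)
    (Pm : E → Measure (ℕ → E)) : Prop where
  prob : ∀ x, IsProbabilityMeasure (Pm x)
  start : ∀ x, Pm x {ω | ω 0 = x} = 1
  markov : ∀ (x : E) (k : ℕ) (A : ℕ → Set E), (∀ i, MeasurableSet (A i)) →
    Pm x {ω | ∀ i < k, ω (i + 1) ∈ A i} = stepProb κ A k x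

/-- The shift on path space. -/
def pathShift {E : Type*} (ω : ℕ → E) : ℕ → E := fun i => ω (i + 1)

section Chain

variable {E : Type*} [MeasurableSpace E]

lemma measurable_pathShift : Measurable (pathShift : (ℕ → E) → ℕ → E) :=
  measurable_pi_lambda _ fun i => measurable_pi_apply (i + 1)

lemma measurable_stepProb (κ : Kernel E E) [IsMarkovKernel κ] (k : ℕ) :
    ∀ A : ℕ → Set E, (∀ i, MeasurableSet (A i)) → Measurable (stepProb κ A k) := by
  induction k with
  | zero => intro A _; exact measurable_const
  | succ k ih =>
    intro A hA
    exact (ih (fun i => A (i + 1)) fun i => hA (i + 1)).setLIntegral_kernel (hA 0)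

lemma measurableSet_box {A : ℕ → Set E} (hA : ∀ i, MeasurableSet (A i)) (k : ℕ) :
    MeasurableSet {ω : ℕ → E | ∀ i < k, ω i ∈ A i} := by
  have : {ω : ℕ → E | ∀ i < k, ω i ∈ A i} = ⋂ i ∈ Finset.range k, (fun ω => ω i) ⁻¹' A i := by
    ext ω; simp
  rw [this]
  exact Finset.measurableSet_biInter _ fun i _ => measurable_pi_apply i (hA i)

/-- A finite-dimensional box is a box over an initial segment of times. -/
lemma exists_box_of_mem_squareCylinders {s : Set (ℕ → E)}
    (hs : s ∈ squareCylinders fun _ : ℕ => {s : Set E | MeasurableSet s}) :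
    ∃ (k : ℕ) (A : ℕ → Set E), (∀ i, MeasurableSet (A i)) ∧ s = {ω | ∀ i < k, ω i ∈ A i} := by
  classical
  obtain ⟨S, t, ht, rfl⟩ := hs
  refine ⟨S.sup id + 1, fun i => if i ∈ S then t i else univ, fun i => ?_, ?_⟩
  · by_cases h : i ∈ S
    · simpa [h] using ht i (mem_univ i)
    · simp [h]
  · ext ω
    constructor
    · intro h i _
      by_cases hi : i ∈ S
      · simpa [hi] using h i hi
      · simp [hi]
    · intro h i hi
      have hle : i ≤ S.sup id := Finset.le_sup (f := id) (Finset.mem_coe.1 hi)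
      have := h i (Nat.lt_succ_of_le hle)
      simpa [Finset.mem_coe.1 hi] using this

namespace IsChainLaw

variable {κ : Kernel E E} {Pm : E → Measure (ℕ → E)}

lemma ae_start_mem (h : IsChainLaw κ Pm) {A : Set E} (hA : MeasurableSet A) (x : E) :
    ∀ᵐ ω ∂Pm x, (ω 0 ∈ A ↔ x ∈ A) := by
  have := h.prob x
  have key : ∀ B : Set E, MeasurableSet B → x ∈ B → ∀ᵐ ω ∂Pm x, ω 0 ∈ B := by
    intro B hB hx
    have hm : MeasurableSet {ω : ℕ → E | ω 0 ∈ B} := measurable_pi_apply 0 hB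
    change {ω : ℕ → E | ω 0 ∈ B} ∈ ae (Pm x)
    rw [mem_ae_iff_prob_eq_one hm]
    refine le_antisymm prob_le_one ?_
    rw [← h.start x]
    refine measure_mono fun ω (hω : ω 0 = x) => ?_
    change ω 0 ∈ B
    rwa [hω]
  by_cases hx : x ∈ A
  · filter_upwards [key A hA hx] with ω hω
    simp [hω, hx]
  · filter_upwards [key Aᶜ hA.compl hx] with ω hω
    simp only [hx, iff_false]; exact hω

lemma ae_start_eq (h : IsChainLaw κ Pm) {g : E → ℝ≥0∞} (hg : Measurable g) (x : E) :
    ∀ᵐ ω ∂Pm x, g (ω 0) = g x := by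
  filter_upwards [h.ae_start_mem (hg (measurableSet_singleton (g x))) x] with ω hω
  exact hω.2 rfl

lemma box_succ (h : IsChainLaw κ Pm) {A : ℕ → Set E} (hA : ∀ i, MeasurableSet (A i))
    (k : ℕ) (x : E) :
    Pm x {ω | ∀ i < k + 1, ω i ∈ A i} =
      (A 0).indicator (stepProb κ (fun i => A (i + 1)) k) x := by
  by_cases hx : x ∈ A 0
  · rw [indicator_of_mem hx, ← h.markov x k _ fun i => hA (i + 1)]
    refine measure_congr ?_
    filter_upwards [h.ae_start_mem (hA 0) x] with ω hω
    refine propext ⟨fun H i hi => H (i + 1) (by omega), fun H i hi => ?_⟩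
    rcases i with _ | i
    · exact hω.2 hx
    · exact H i (by omega)
  · rw [indicator_of_notMem hx]
    rw [measure_eq_zero_iff_ae_notMem]
    filter_upwards [h.ae_start_mem (hA 0) x] with ω hω H
    exact hx (hω.1 (H 0 (by omega)))

lemma measurable_law [IsMarkovKernel κ] (h : IsChainLaw κ Pm) : Measurable Pm := by
  have := h.prob
  refine Measurable.measure_of_isPiSystem_of_isProbabilityMeasure
    generateFrom_squareCylinders.symm
    (isPiSystem_squareCylinders (fun _ => MeasurableSpace.isPiSystem_measurableSet) (by simp)) ?_
  intro s hs
  obtain ⟨k, A, hA, rfl⟩ := exists_box_of_mem_squareCylinders hs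
  rcases k with _ | k
  · simp
  · simp_rw [h.box_succ hA k]
    exact (measurable_stepProb κ k _ fun i => hA (i + 1)).indicator (hA 0)

/-- The simple Markov property at time one. -/
lemma map_pathShift [IsMarkovKernel κ] (h : IsChainLaw κ Pm) (x : E) :
    (Pm x).map pathShift = Measure.bind (κ x) Pm := by
  have := h.prob
  have huniv : Measure.bind (κ x) Pm univ = 1 := by
    rw [Measure.bind_apply MeasurableSet.univ h.measurable_law.aemeasurable]; simp
  have : IsProbabilityMeasure ((Pm x).map pathShift) :=
    Measure.isProbabilityMeasure_map measurable_pathShift.aemeasurable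
  refine ext_of_generate_finite _ generateFrom_squareCylinders.symm
    (isPiSystem_squareCylinders (fun _ => MeasurableSpace.isPiSystem_measurableSet) (by simp)) ?_
    (by rw [huniv, measure_univ])
  intro s hs
  obtain ⟨k, A, hA, rfl⟩ := exists_box_of_mem_squareCylinders hs
  rw [Measure.map_apply measurable_pathShift (measurableSet_box hA k),
    Measure.bind_apply (measurableSet_box hA k) h.measurable_law.aemeasurable]
  rcases k with _ | k
  · simp
  · simp_rw [h.box_succ hA k]
    rw [lintegral_indicator (hA 0)]
    exact h.markov x (k + 1) A hA

lemma lintegral_pathShift [IsMarkovKernel κ] (h : IsChainLaw κ Pm) (x : E)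
    {F : (ℕ → E) → ℝ≥0∞} (hF : Measurable F) :
    ∫⁻ ω, F (pathShift ω) ∂Pm x = ∫⁻ y, ∫⁻ ω, F ω ∂Pm y ∂κ x := by
  rw [← lintegral_map hF measurable_pathShift, h.map_pathShift x,
    Measure.lintegral_bind h.measurable_law.aemeasurable hF.aemeasurable]

lemma measurable_lintegral [IsMarkovKernel κ] (h : IsChainLaw κ Pm)
    {F : (ℕ → E) → ℝ≥0∞} (hF : Measurable F) : Measurable fun x => ∫⁻ ω, F ω ∂Pm x :=
  (Measure.measurable_lintegral hF).comp h.measurable_law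

end IsChainLaw

/-- The path functionals obtained by iterating `F ↦ K₁(ω₁) + K₂(ω₁) F(shift ω)`, started from
the constant `c`. -/
def affineFun (c : ℝ≥0∞) (K₁ K₂ : E → ℝ≥0∞) : ℕ → (ℕ → E) → ℝ≥0∞
  | 0, _ => c
  | n + 1, ω => K₁ (ω 1) + K₂ (ω 1) * affineFun c K₁ K₂ n (pathShift ω)

lemma measurable_affineFun (c : ℝ≥0∞) {K₁ K₂ : E → ℝ≥0∞} (h₁ : Measurable K₁)
    (h₂ : Measurable K₂) (n : ℕ) : Measurable (affineFun c K₁ K₂ n) := by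
  induction n with
  | zero => exact measurable_const
  | succ n ih =>
    exact (h₁.comp (measurable_pi_apply 1)).add
      ((h₂.comp (measurable_pi_apply 1)).mul (ih.comp measurable_pathShift))

lemma IsChainLaw.lintegral_affineFun_succ {κ : Kernel E E} [IsMarkovKernel κ]
    {Pm : E → Measure (ℕ → E)} (h : IsChainLaw κ Pm) (c : ℝ≥0∞) {K₁ K₂ : E → ℝ≥0∞}
    (h₁ : Measurable K₁) (h₂ : Measurable K₂) (n : ℕ) (x : E) :
    ∫⁻ ω, affineFun c K₁ K₂ (n + 1) ω ∂Pm x =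
      ∫⁻ y, (K₁ y + K₂ y * ∫⁻ ω, affineFun c K₁ K₂ n ω ∂Pm y) ∂κ x := by
  have hm := measurable_affineFun c h₁ h₂ n
  have hF : Measurable fun ω : ℕ → E => K₁ (ω 0) + K₂ (ω 0) * affineFun c K₁ K₂ n ω :=
    (h₁.comp (measurable_pi_apply 0)).add ((h₂.comp (measurable_pi_apply 0)).mul hm)
  refine (h.lintegral_pathShift x hF).trans (lintegral_congr fun y => ?_)
  have := h.prob y
  rw [← lintegral_const_mul _ hm]
  have e : ∀ᵐ ω ∂Pm y, K₁ (ω 0) + K₂ (ω 0) * affineFun c K₁ K₂ n ω =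
      K₁ y + K₂ y * affineFun c K₁ K₂ n ω := by
    filter_upwards [h.ae_start_eq h₁ y, h.ae_start_eq h₂ y] with ω e₁ e₂
    rw [e₁, e₂]
  rw [lintegral_congr_ae e, lintegral_add_left measurable_const]
  simp

end Chain

/-! ### Exponential bounds for sums over excursions and for the number of visits -/

section Excursion

variable {E : Type*}

/-- The sum `|f(ω₁)| + ⋯ + |f(ωₙ)|`. -/
def absSum (f : E → ℝ) (n : ℕ) (ω : ℕ → E) : ℝ := ∑ i ∈ Finset.range n, |f (ω (i + 1))|

/-- The number of visits of `ω` to `a` during the times `1, …, n`. -/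
def visits (a : Set E) (n : ℕ) (ω : ℕ → E) : ℕ :=
  ∑ i ∈ Finset.range n, a.indicator (fun _ => 1) (ω (i + 1))

lemma absSum_nonneg (f : E → ℝ) (n : ℕ) (ω : ℕ → E) : 0 ≤ absSum f n ω :=
  Finset.sum_nonneg fun _ _ => abs_nonneg _

lemma absSum_succ (f : E → ℝ) (n : ℕ) (ω : ℕ → E) :
    absSum f (n + 1) ω = |f (ω 1)| + absSum f n (pathShift ω) := by
  rw [absSum, Finset.sum_range_succ', add_comm]; rfl

lemma visits_succ (a : Set E) (n : ℕ) (ω : ℕ → E) :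
    visits a (n + 1) ω = a.indicator (fun _ => 1) (ω 1) + visits a n (pathShift ω) := by
  rw [visits, Finset.sum_range_succ', add_comm]; rfl

lemma visits_le (a : Set E) (n : ℕ) (ω : ℕ → E) : visits a n ω ≤ n := by
  refine (Finset.sum_le_card_nsmul _ _ 1 fun i _ => ?_).trans (by simp)
  exact indicator_le_self' (f := fun _ : E => 1) (by simp) _

lemma sum_Icc_one_eq_absSum (f : E → ℝ) (n : ℕ) (ω : ℕ → E) :
    ∑ i ∈ Finset.Icc 1 n, |f (ω i)| = absSum f n ω := by
  induction n with
  | zero => simp [absSum]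
  | succ n ih =>
    rw [Finset.sum_Icc_succ_top (by omega), ih, absSum, absSum, Finset.sum_range_succ]

/-- If `a` is visited at some positive time, then `hitT` is such a time. -/
lemma hitT_toNat_spec {a : Set E} {ω : ℕ → E} (h : ∃ n, 0 < n ∧ ω n ∈ a) :
    0 < (hitT a ω).toNat ∧ ω (hitT a ω).toNat ∈ a := by
  classical
  have e : hitT a ω = (Nat.find h : ℕ∞) := by
    refine le_antisymm (iInf₂_le (Nat.find h) (Nat.find_spec h)) ?_
    exact le_iInf₂ fun n hn => Nat.cast_le.2 (Nat.find_min' h hn)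
  rw [e]
  exact Nat.find_spec h

lemma affineFun_le_exp_absSum (a : Set E) (f : E → ℝ) {p : ℝ} (hp : 0 ≤ p) (n : ℕ) :
    ∀ (ω : ℕ → E) (T : ℕ), 0 < T → ω T ∈ a →
      affineFun 1 (a.indicator fun y => ENNReal.ofReal (Real.exp (p * |f y|)))
        (aᶜ.indicator fun y => ENNReal.ofReal (Real.exp (p * |f y|))) n ω ≤
      ENNReal.ofReal (Real.exp (p * absSum f T ω)) := by
  induction n with
  | zero =>
    intro ω T _ _
    rw [affineFun, ← ENNReal.ofReal_one]
    exact ENNReal.ofReal_le_ofReal (Real.one_le_exp (mul_nonneg hp (absSum_nonneg _ _ _)))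
  | succ n ih =>
    intro ω T hT hTa
    obtain ⟨T, rfl⟩ : ∃ T', T = T' + 1 := ⟨T - 1, by omega⟩
    rw [affineFun, absSum_succ]
    by_cases h1 : ω 1 ∈ a
    · rw [indicator_of_mem h1, indicator_of_notMem (by simpa using h1), zero_mul, add_zero]
      refine ENNReal.ofReal_le_ofReal (Real.exp_le_exp.2 (mul_le_mul_of_nonneg_left ?_ hp))
      linarith [absSum_nonneg f T (pathShift ω)]
    · rw [indicator_of_notMem h1, indicator_of_mem (by simpa using h1), zero_add, mul_add,
        Real.exp_add, ENNReal.ofReal_mul (Real.exp_nonneg _)]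
      gcongr
      refine ih (pathShift ω) T (Nat.pos_of_ne_zero ?_) hTa
      rintro rfl
      exact h1 hTa

lemma affineFun_zero_le_exp (a : Set E) {u : ℝ} (hu : 0 ≤ u) (n : ℕ) :
    ∀ (ω : ℕ → E) (x : ℝ), (∀ k : ℕ, 0 < k → (k : ℝ) ≤ x → ω k ∉ a) →
      affineFun 0 (a.indicator fun _ => ENNReal.ofReal (Real.exp (-u)))
        (aᶜ.indicator fun _ => ENNReal.ofReal (Real.exp (-u))) n ω ≤
      ENNReal.ofReal (Real.exp (-u * x)) := by
  induction n with
  | zero => intro ω x _; exact zero_le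
  | succ n ih =>
    intro ω x hx
    rw [affineFun]
    by_cases h1 : ω 1 ∈ a
    · rw [indicator_of_mem h1, indicator_of_notMem (by simpa using h1), zero_mul, add_zero]
      have hx1 : x < 1 := by
        by_contra! hc
        exact hx 1 one_pos (by simpa using hc) h1
      refine ENNReal.ofReal_le_ofReal (Real.exp_le_exp.2 ?_)
      nlinarith
    · rw [indicator_of_notMem h1, indicator_of_mem (by simpa using h1), zero_add]
      have e : -u * x = -u + -u * (x - 1) := by ring
      rw [e, Real.exp_add, ENNReal.ofReal_mul (Real.exp_nonneg _)]
      gcongr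
      refine ih (pathShift ω) (x - 1) fun k hk hkx => hx (k + 1) k.succ_pos ?_
      push_cast
      linarith

variable [MeasurableSpace E]

lemma measurable_absSum {f : E → ℝ} (hf : Measurable f) (n : ℕ) : Measurable (absSum f n) :=
  Finset.measurable_sum _ fun i _ => (hf.comp (measurable_pi_apply (i + 1))).abs

lemma measurable_visits {a : Set E} (ha : MeasurableSet a) (n : ℕ) : Measurable (visits a n) :=
  Finset.measurable_sum _ fun i _ =>
    (measurable_const.indicator ha).comp (measurable_pi_apply (i + 1))

variable {κ : Kernel E E} [IsMarkovKernel κ] {Pm : E → Measure (ℕ → E)}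

/-- If one excursion has an exponential moment at most `exp L`, then discounting by `exp (-L)`
at every visit to the atom keeps the exponential moment of the whole sum below `exp L`. -/
lemma IsChainLaw.lintegral_exp_absSum_sub_visits_le (h : IsChainLaw κ Pm) {a : Set E}
    (ha : MeasurableSet a) (hrec : ∀ x, ∀ᵐ ω ∂Pm x, ∃ n, 0 < n ∧ ω n ∈ a)
    {f : E → ℝ} (hf : Measurable f) {p L : ℝ} (hp : 0 ≤ p)
    (hexc : ∀ x, ∫⁻ ω, ENNReal.ofReal
      (Real.exp (p * ∑ i ∈ Finset.Icc 1 (hitT a ω).toNat, |f (ω i)|)) ∂Pm x ≤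
        ENNReal.ofReal (Real.exp L)) (n : ℕ) (x : E) :
    ∫⁻ ω, ENNReal.ofReal (Real.exp (p * absSum f n ω - L * visits a n ω)) ∂Pm x ≤
      ENNReal.ofReal (Real.exp L) := by
  set w : E → ℝ≥0∞ := fun y => ENNReal.ofReal (Real.exp (p * |f y|)) with hw
  have hwm : Measurable w := by fun_prop
  set v : E → ℝ≥0∞ := fun y =>
    w y * (a.indicator (fun _ => ENNReal.ofReal (Real.exp (-L))) y + aᶜ.indicator 1 y) with hv
  have hvm : Measurable v := hwm.mul
    ((measurable_const.indicator ha).add (measurable_one.indicator ha.compl))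
  have hXm₁ : Measurable (a.indicator w) := hwm.indicator ha
  have hXm₂ : Measurable (aᶜ.indicator w) := hwm.indicator ha.compl
  have hX : ∀ n x, ∫⁻ ω, affineFun 1 (a.indicator w) (aᶜ.indicator w) n ω ∂Pm x ≤
      ENNReal.ofReal (Real.exp L) := by
    intro n x
    refine le_trans (lintegral_mono_ae ?_) (hexc x)
    filter_upwards [hrec x] with ω hω
    rw [sum_Icc_one_eq_absSum]
    exact affineFun_le_exp_absSum a f hp n ω _ (hitT_toNat_spec hω).1 (hitT_toNat_spec hω).2
  have hpath : ∀ (n : ℕ) (ω : ℕ → E), affineFun 1 0 v n ω =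
      ENNReal.ofReal (Real.exp (p * absSum f n ω - L * visits a n ω)) := by
    intro n
    induction n with
    | zero => intro ω; simp [affineFun, absSum, visits]
    | succ n ih =>
      intro ω
      rw [affineFun, ih, absSum_succ, visits_succ]
      simp only [Pi.zero_apply, zero_add, hv, hw]
      by_cases h1 : ω 1 ∈ a
      · rw [indicator_of_mem h1, indicator_of_notMem (by simpa using h1), indicator_of_mem h1,
          add_zero, ← ENNReal.ofReal_mul (Real.exp_nonneg _),
          ← ENNReal.ofReal_mul (by positivity), ← Real.exp_add, ← Real.exp_add]
        push_cast
        congr 2; ring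
      · rw [indicator_of_notMem h1, indicator_of_mem (by simpa using h1), indicator_of_notMem h1,
          Pi.one_apply, zero_add, mul_one,
          ← ENNReal.ofReal_mul (by positivity), ← Real.exp_add]
        push_cast
        congr 2; ring
  have hYX : ∀ (n : ℕ) (x : E), ∫⁻ ω, affineFun 1 0 v n ω ∂Pm x ≤
      ∫⁻ ω, affineFun 1 (a.indicator w) (aᶜ.indicator w) n ω ∂Pm x := by
    intro n
    induction n with
    | zero => intro x; exact le_rfl
    | succ n ih =>
      intro x
      rw [h.lintegral_affineFun_succ 1 measurable_zero hvm,
        h.lintegral_affineFun_succ 1 hXm₁ hXm₂]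
      refine lintegral_mono fun y => ?_
      simp only [Pi.zero_apply, zero_add, hv]
      by_cases hy : y ∈ a
      · rw [indicator_of_mem hy, indicator_of_notMem (by simpa using hy), indicator_of_mem hy,
          indicator_of_notMem (by simpa using hy), add_zero, zero_mul, add_zero, mul_assoc]
        calc w y * (ENNReal.ofReal (Real.exp (-L)) * ∫⁻ ω, affineFun 1 0 v n ω ∂Pm y)
            ≤ w y * (ENNReal.ofReal (Real.exp (-L)) * ENNReal.ofReal (Real.exp L)) := by
              gcongr
              exact (ih y).trans (hX n y)
          _ = w y := by
              rw [← ENNReal.ofReal_mul (by positivity), ← Real.exp_add]; simp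
      · rw [indicator_of_notMem hy, indicator_of_mem (by simpa using hy), indicator_of_notMem hy,
          indicator_of_mem (by simpa using hy), Pi.one_apply, zero_add, mul_one, zero_add]
        exact mul_le_mul' le_rfl (ih y)
  calc ∫⁻ ω, ENNReal.ofReal (Real.exp (p * absSum f n ω - L * visits a n ω)) ∂Pm x
      = ∫⁻ ω, affineFun 1 0 v n ω ∂Pm x := lintegral_congr fun ω => (hpath n ω).symm
    _ ≤ _ := (hYX n x).trans (hX n x)

/-- Many visits to the atom by time `n` are exponentially unlikely. -/
lemma IsChainLaw.measure_visits_le (h : IsChainLaw κ Pm) {a : Set E} (ha : MeasurableSet a)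
    {u : ℝ} (hu : 0 ≤ u) {φ : ℝ≥0∞}
    (hφ : ∀ (n : ℕ), ∀ y ∈ a, ∫⁻ ω, affineFun 0
      (a.indicator fun _ => ENNReal.ofReal (Real.exp (-u)))
      (aᶜ.indicator fun _ => ENNReal.ofReal (Real.exp (-u))) n ω ∂Pm y ≤ φ) (n : ℕ) :
    ∀ (m : ℕ) (x : E), Pm x {ω | m + 1 ≤ visits a n ω} ≤
      ENNReal.ofReal (Real.exp (u * n)) * φ ^ m * ∫⁻ ω, affineFun 0
      (a.indicator fun _ => ENNReal.ofReal (Real.exp (-u)))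
      (aᶜ.indicator fun _ => ENNReal.ofReal (Real.exp (-u))) n ω ∂Pm x := by
  set K₁ : E → ℝ≥0∞ := a.indicator fun _ => ENNReal.ofReal (Real.exp (-u)) with hK₁
  set K₂ : E → ℝ≥0∞ := aᶜ.indicator fun _ => ENNReal.ofReal (Real.exp (-u)) with hK₂
  have h₁ : Measurable K₁ := measurable_const.indicator ha
  have h₂ : Measurable K₂ := measurable_const.indicator ha.compl
  induction n with
  | zero => intro m x; simp [visits]
  | succ n ih =>
    intro m x
    have hset : MeasurableSet {ω : ℕ → E |
        m + 1 ≤ a.indicator (fun _ => 1) (ω 0) + visits a n ω} :=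
      measurableSet_le measurable_const
        (((measurable_const.indicator ha).comp (measurable_pi_apply 0)).add
          (measurable_visits ha n))
    have e1 : Pm x {ω | m + 1 ≤ visits a (n + 1) ω} =
        ∫⁻ y, Pm y {ω | m + 1 ≤ a.indicator (fun _ => 1) (ω 0) + visits a n ω} ∂κ x := by
      have e : {ω | m + 1 ≤ visits a (n + 1) ω} = pathShift ⁻¹' {ω : ℕ → E |
          m + 1 ≤ a.indicator (fun _ => 1) (ω 0) + visits a n ω} := by
        ext ω
        change m + 1 ≤ visits a (n + 1) ω ↔ _
        rw [visits_succ]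
        rfl
      rw [e, ← Measure.map_apply measurable_pathShift hset, h.map_pathShift,
        Measure.bind_apply hset h.measurable_law.aemeasurable]
    rw [e1, h.lintegral_affineFun_succ 0 h₁ h₂, ← lintegral_const_mul]
    swap
    · exact h₁.add (h₂.mul (h.measurable_lintegral (measurable_affineFun 0 h₁ h₂ n)))
    refine lintegral_mono fun y => ?_
    have hexp : ENNReal.ofReal (Real.exp (u * (n + 1 : ℕ))) * ENNReal.ofReal (Real.exp (-u)) =
        ENNReal.ofReal (Real.exp (u * n)) := by
      rw [← ENNReal.ofReal_mul (Real.exp_nonneg _), ← Real.exp_add]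
      push_cast
      congr 2; ring
    by_cases hy : y ∈ a
    · have e2 : Pm y {ω | m + 1 ≤ a.indicator (fun _ => 1) (ω 0) + visits a n ω} =
          Pm y {ω | m ≤ visits a n ω} := by
        refine measure_congr ?_
        filter_upwards [h.ae_start_mem ha y] with ω hω
        refine propext ?_
        change m + 1 ≤ a.indicator (fun _ => 1) (ω 0) + visits a n ω ↔ m ≤ visits a n ω
        rw [indicator_of_mem (hω.2 hy)]
        omega
      have e3 : K₁ y + K₂ y * ∫⁻ ω, affineFun 0 K₁ K₂ n ω ∂Pm y =
          ENNReal.ofReal (Real.exp (-u)) := by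
        rw [hK₁, hK₂, indicator_of_mem hy, indicator_of_notMem (by simpa using hy), zero_mul,
          add_zero]
      rw [e2, e3, mul_right_comm, hexp]
      rcases m with _ | m
      · have := h.prob y
        rw [pow_zero, mul_one]
        refine prob_le_one.trans ?_
        rw [← ENNReal.ofReal_one]
        exact ENNReal.ofReal_le_ofReal (Real.one_le_exp (by positivity))
      · refine (ih m y).trans ?_
        rw [pow_succ, ← mul_assoc]
        gcongr
        exact hφ n y hy
    · have e2 : Pm y {ω | m + 1 ≤ a.indicator (fun _ => 1) (ω 0) + visits a n ω} =
          Pm y {ω | m + 1 ≤ visits a n ω} := by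
        refine measure_congr ?_
        filter_upwards [h.ae_start_mem ha y] with ω hω
        refine propext ?_
        change m + 1 ≤ a.indicator (fun _ => 1) (ω 0) + visits a n ω ↔ m + 1 ≤ visits a n ω
        rw [indicator_of_notMem fun hc => hy (hω.1 hc), zero_add]
      have e3 : K₁ y + K₂ y * ∫⁻ ω, affineFun 0 K₁ K₂ n ω ∂Pm y =
          ENNReal.ofReal (Real.exp (-u)) * ∫⁻ ω, affineFun 0 K₁ K₂ n ω ∂Pm y := by
        rw [hK₁, hK₂, indicator_of_notMem hy, indicator_of_mem (by simpa using hy), zero_add]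
      rw [e2, e3, ← mul_assoc, mul_right_comm _ _ (ENNReal.ofReal (Real.exp (-u))), hexp]
      exact ih m y

/-- The Laplace transform of the return time to the atom, truncated at a finite horizon,
is controlled by the tail of the return time. -/
lemma IsChainLaw.lintegral_affineFun_zero_le (h : IsChainLaw κ Pm) {a : Set E}
    (ha : MeasurableSet a) (hatom : ∀ x ∈ a, ∀ y ∈ a, κ x = κ y) {xa : E} (hxa : xa ∈ a)
    {u : ℝ} (hu : 0 < u) (n : ℕ) {y : E} (hy : y ∈ a) :
    ∫⁻ ω, affineFun 0 (a.indicator fun _ => ENNReal.ofReal (Real.exp (-u)))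
      (aᶜ.indicator fun _ => ENNReal.ofReal (Real.exp (-u))) n ω ∂Pm y ≤
    ENNReal.ofReal (1 - (1 - Real.exp (-1)) *
      (Pm xa {ω | ∀ k : ℕ, 0 < k → (k : ℝ) ≤ 1 / u → ω k ∉ a}).toReal) := by
  have := h.prob xa
  have hm₁ : Measurable (a.indicator fun _ : E => ENNReal.ofReal (Real.exp (-u))) :=
    measurable_const.indicator ha
  have hm₂ : Measurable (aᶜ.indicator fun _ : E => ENNReal.ofReal (Real.exp (-u))) :=
    measurable_const.indicator ha.compl
  rcases n with _ | n
  · simp [affineFun]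
  rw [h.lintegral_affineFun_succ 0 hm₁ hm₂, hatom y hy xa hxa,
    ← h.lintegral_affineFun_succ 0 hm₁ hm₂]
  set B : Set (ℕ → E) := {ω | ∀ k : ℕ, 0 < k → (k : ℝ) ≤ 1 / u → ω k ∉ a} with hB
  have hBm : MeasurableSet B := by
    have : B = ⋂ k : ℕ, {ω | 0 < k → (k : ℝ) ≤ 1 / u → ω k ∉ a} := by ext ω; simp [hB]
    rw [this]
    refine MeasurableSet.iInter fun k => ?_
    by_cases h1 : 0 < k <;> by_cases h2 : (k : ℝ) ≤ 1 / u
    · simp only [h1, h2, forall_const]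
      exact (measurable_pi_apply k : Measurable fun ω : ℕ → E => ω k) ha.compl
    all_goals simp only [h1, h2, false_imp_iff, imp_true_iff, forall_const, ofPred_true,
      MeasurableSet.univ]
  have hpt : ∀ ω, affineFun 0 (a.indicator fun _ => ENNReal.ofReal (Real.exp (-u)))
      (aᶜ.indicator fun _ => ENNReal.ofReal (Real.exp (-u))) (n + 1) ω ≤
      B.indicator (fun _ => ENNReal.ofReal (Real.exp (-1))) ω + Bᶜ.indicator 1 ω := by
    intro ω
    by_cases hω : ω ∈ B
    · rw [indicator_of_mem hω, indicator_of_notMem (by simpa using hω), add_zero]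
      refine (affineFun_zero_le_exp a hu.le (n + 1) ω (1 / u) hω).trans_eq ?_
      congr 2; field_simp
    · rw [indicator_of_notMem hω, indicator_of_mem (by simpa using hω), Pi.one_apply, zero_add]
      refine (affineFun_zero_le_exp a hu.le (n + 1) ω 0 ?_).trans_eq (by simp)
      intro k hk hk0
      exact absurd hk0 (by simpa using hk.ne')
  refine (lintegral_mono hpt).trans_eq ?_
  rw [lintegral_add_left (measurable_const.indicator hBm), lintegral_indicator_const hBm,
    lintegral_indicator_one hBm.compl, prob_compl_eq_one_sub hBm,
    ← ENNReal.ofReal_toReal (measure_ne_top (Pm xa) B), ← ENNReal.ofReal_one,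
    ← ENNReal.ofReal_sub _ ENNReal.toReal_nonneg, ← ENNReal.ofReal_mul (Real.exp_nonneg _),
    ← ENNReal.ofReal_add (by positivity)]
  · congr 1
    rw [ENNReal.toReal_ofReal ENNReal.toReal_nonneg]
    ring
  · have : (Pm xa B).toReal ≤ 1 := by
      simpa using ENNReal.toReal_mono ENNReal.one_ne_top (prob_le_one (μ := Pm xa) (s := B))
    linarith

end Excursion

/-! ### Regular variation -/

lemma RegVary.exists_potter_bound {γ : ℝ → ℝ} {α q : ℝ} (h : RegVary γ α) (hpos : ∀ x, 0 < γ x)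
    (hq0 : 0 < q) (hq : q < α) (hmono : Monotone γ) :
    ∃ t₀ : ℝ, 1 ≤ t₀ ∧ ∀ t, t₀ ≤ t → ∀ v, 1 ≤ v → (v / 2) ^ q * γ t ≤ γ (v * t) := by
  have h2 : (2 : ℝ) ^ q < 2 ^ α := Real.rpow_lt_rpow_of_exponent_lt (by norm_num) hq
  obtain ⟨t₀, ht₀⟩ := eventually_atTop.1
    (((h 2 two_pos).eventually (eventually_gt_nhds h2)).and (eventually_ge_atTop 1))
  refine ⟨max t₀ 1, le_max_right _ _, fun t ht v hv => ?_⟩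
  have ht1 : 1 ≤ t := (le_max_right _ _).trans ht
  have hpow : ∀ k : ℕ, ((2 : ℝ) ^ q) ^ k * γ t ≤ γ (2 ^ k * t) := by
    intro k
    induction k with
    | zero => simp
    | succ k ih =>
      have hk : t ≤ 2 ^ k * t := le_mul_of_one_le_left (by linarith) (one_le_pow₀ (by norm_num))
      have := (ht₀ (2 ^ k * t) ((le_max_left _ _).trans (ht.trans hk))).1
      rw [lt_div_iff₀ (hpos _)] at this
      calc ((2 : ℝ) ^ q) ^ (k + 1) * γ t = 2 ^ q * (((2 : ℝ) ^ q) ^ k * γ t) := by ring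
        _ ≤ 2 ^ q * γ (2 ^ k * t) := by gcongr
        _ ≤ γ (2 ^ k * t * 2) := this.le
        _ = γ (2 ^ (k + 1) * t) := by congr 1; ring
  obtain ⟨k, hk1, hk2⟩ := exists_nat_pow_near hv (one_lt_two : (1 : ℝ) < 2)
  have hle : (v / 2) ^ q ≤ ((2 : ℝ) ^ q) ^ k := by
    rw [← Real.rpow_natCast, ← Real.rpow_mul (by norm_num), mul_comm, Real.rpow_mul (by norm_num),
      Real.rpow_natCast]
    refine Real.rpow_le_rpow (by linarith) ?_ hq0.le
    rw [pow_succ] at hk2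
    linarith
  calc (v / 2) ^ q * γ t ≤ ((2 : ℝ) ^ q) ^ k * γ t := by
        have := (hpos t).le
        gcongr
    _ ≤ γ (2 ^ k * t) := hpow k
    _ ≤ γ (v * t) := hmono (by gcongr)

lemma tendsto_rpow_div_rpow_atTop {γ : ℝ → ℝ} {q δ t₀ : ℝ} (hpos : ∀ x, 0 < γ x)
    (hδ : 1 ≤ δ) (hqδ : δ * (1 - q) < 1) (ht₀ : 1 ≤ t₀)
    (hpot : ∀ t, t₀ ≤ t → ∀ v, 1 ≤ v → (v / 2) ^ q * γ t ≤ γ (v * t)) :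
    Tendsto (fun n : ℕ => γ n ^ δ / (n : ℝ) ^ (δ - 1)) atTop atTop := by
  have ht : 0 < t₀ := by linarith
  set c : ℝ := ((1 / (2 * t₀)) ^ q * γ t₀) ^ δ with hc
  have hcpos : 0 < c := by have := hpos t₀; positivity
  have hlim : Tendsto (fun n : ℕ => c * (n : ℝ) ^ (q * δ - (δ - 1))) atTop atTop :=
    ((tendsto_rpow_atTop (by nlinarith)).comp tendsto_natCast_atTop_atTop).const_mul_atTop hcpos
  refine tendsto_atTop_mono' _ ?_ hlim
  filter_upwards [eventually_ge_atTop ⌈t₀⌉₊] with n hn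
  have hn' : t₀ ≤ n := Nat.ceil_le.1 hn
  have hn0 : (0 : ℝ) < n := by linarith
  have := hpot t₀ le_rfl (n / t₀) ((one_le_div ht).2 hn')
  rw [div_mul_cancel₀ _ ht.ne'] at this
  rw [le_div_iff₀ (by positivity), mul_assoc, ← Real.rpow_add hn0, sub_add_cancel,
    Real.rpow_mul hn0.le, hc, ← Real.mul_rpow (by have := hpos t₀; positivity) (by positivity)]
  refine Real.rpow_le_rpow (by have := hpos t₀; positivity) ?_ (by linarith)
  calc (1 / (2 * t₀)) ^ q * γ t₀ * (n : ℝ) ^ q = (n / t₀ / 2) ^ q * γ t₀ := by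
        rw [mul_right_comm, ← Real.mul_rpow (by positivity) hn0.le]
        congr 2; field_simp
    _ ≤ γ n := this

/-! ### The tail of the normalized partial sums -/

section Tail

variable {E : Type*} [MeasurableSpace E] {κ : Kernel E E} [IsMarkovKernel κ]
  {Pm : E → Measure (ℕ → E)}

lemma IsChainLaw.exists_visits_tail (h : IsChainLaw κ Pm) {a : Set E}
    (ha : MeasurableSet a) (hatom : ∀ x ∈ a, ∀ y ∈ a, κ x = κ y) {xa : E} (hxa : xa ∈ a)
    {γ : ℝ → ℝ} {q δ t₀ c : ℝ} (hc : 0 < c) (hpos : ∀ x, 0 < γ x) (hmono : Monotone γ)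
    (hγ : ∀ x : ℝ, (c * γ x)⁻¹ =
      (Pm xa {ω | ∀ k : ℕ, 0 < k → (k : ℝ) ≤ x → ω k ∉ a}).toReal)
    (hδ : 1 ≤ δ) (hqδ : δ * (1 - q) < 1) (ht₀ : 1 ≤ t₀)
    (hpot : ∀ t, t₀ ≤ t → ∀ v, 1 ≤ v → (v / 2) ^ q * γ t ≤ γ (v * t))
    {k η : ℝ} (hk : 0 < k) (hη : 0 < η) :
    ∃ (w₀ : ℝ) (K : ℕ), ∀ n, K ≤ n → ∀ w, w₀ ≤ w → ∀ x,
      Pm x {ω | η * w * γ n ≤ visits a n ω} ≤ ENNReal.ofReal (Real.exp (-k * w ^ δ)) := by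
  have hδ0 : 0 < δ := by linarith
  set b : ℝ := 1 - Real.exp (-1) with hb
  have hb0 : 0 < b := by rw [hb, sub_pos, Real.exp_lt_one_iff]; norm_num
  set c₁ : ℝ := b * (k / 2) ^ q * η / (2 * c) with hc₁
  have hc₁0 : 0 < c₁ := by positivity
  have hw : ∀ᶠ w : ℝ in atTop, 0 < w ∧ 1 ≤ k * w ^ δ ∧ 2 ≤ η * w * γ 0 ∧
      2 * k / c₁ ≤ w ^ (q * δ + 1 - δ) := by
    refine (eventually_gt_atTop 0).and (Eventually.and ?_ (Eventually.and ?_ ?_))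
    · exact ((tendsto_rpow_atTop hδ0).const_mul_atTop hk).eventually_ge_atTop 1
    · exact ((tendsto_id.const_mul_atTop hη).atTop_mul_const (hpos 0)).eventually_ge_atTop 2
    · exact (tendsto_rpow_atTop (by nlinarith)).eventually_ge_atTop _
  obtain ⟨w₀, hw₀⟩ := eventually_atTop.1 hw
  obtain ⟨K, hK⟩ := eventually_atTop.1
    (((tendsto_rpow_div_rpow_atTop hpos hδ hqδ ht₀ hpot).eventually_ge_atTop
      (k * t₀ / η ^ δ)).and (eventually_ge_atTop 1))
  refine ⟨w₀, K, fun n hn w hww x => ?_⟩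
  obtain ⟨hw0, hv1, hw2, hw3⟩ := hw₀ w hww
  obtain ⟨hD, hn1⟩ := hK n hn
  have hn0 : (0 : ℝ) < n := by exact_mod_cast hn1
  have hγn := hpos n
  by_cases hle : η * w * γ n ≤ n
  swap
  · have : {ω : ℕ → E | η * w * γ n ≤ visits a n ω} = ∅ := by
      refine eq_empty_of_forall_notMem fun ω (hω : η * w * γ n ≤ visits a n ω) => hle ?_
      exact hω.trans (by exact_mod_cast visits_le a n ω)
    rw [this, measure_empty]
    exact zero_le
  set v : ℝ := k * w ^ δ with hv
  have hv0 : 0 < v := by positivity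
  have hvn : v * t₀ ≤ n := by
    have h1 : (η * w) ^ δ * γ n ^ δ ≤ (n : ℝ) ^ δ := by
      rw [← Real.mul_rpow (by positivity) hγn.le]
      exact Real.rpow_le_rpow (by positivity) hle hδ0.le
    have h2 : k * t₀ * (n : ℝ) ^ (δ - 1) ≤ γ n ^ δ * η ^ δ := by
      rw [div_le_div_iff₀ (by positivity) (by positivity)] at hD
      exact hD
    have h3 : (n : ℝ) ^ δ = (n : ℝ) ^ (δ - 1) * n := by
      rw [← Real.rpow_add_one hn0.ne', sub_add_cancel]
    rw [Real.mul_rpow hη.le hw0.le, h3] at h1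
    have h4 : (0 : ℝ) < (n : ℝ) ^ (δ - 1) := by positivity
    refine le_of_mul_le_mul_left ?_ h4
    calc (n : ℝ) ^ (δ - 1) * (v * t₀) = (k * t₀ * (n : ℝ) ^ (δ - 1)) * w ^ δ := by rw [hv]; ring
      _ ≤ γ n ^ δ * η ^ δ * w ^ δ := by gcongr
      _ = η ^ δ * w ^ δ * γ n ^ δ := by ring
      _ ≤ _ := h1
  have hpv : (v / 2) ^ q * γ (n / v) ≤ γ n := by
    have := hpot (n / v) (by rw [le_div_iff₀ hv0]; linarith) v hv1
    rwa [mul_div_cancel₀ _ hv0.ne'] at this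
  set u : ℝ := v / n with hu
  have hu0 : 0 < u := by positivity
  have hu1 : 1 / u = n / v := by rw [hu, one_div_div]
  set τ : ℝ := (Pm xa {ω | ∀ k : ℕ, 0 < k → (k : ℝ) ≤ 1 / u → ω k ∉ a}).toReal with hτ
  have hτle : (v / 2) ^ q / (c * γ n) ≤ τ := by
    rw [hτ, ← hγ, hu1, ← one_div, div_le_div_iff₀ (by positivity)
      (mul_pos hc (hpos _))]
    nlinarith
  have hγ0 : γ 0 ≤ γ n := hmono hn0.le
  have hm2 : 2 ≤ η * w * γ n := hw2.trans (by gcongr)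
  obtain ⟨m, hm⟩ : ∃ m : ℕ, ⌈η * w * γ n⌉₊ = m + 1 :=
    ⟨⌈η * w * γ n⌉₊ - 1, by have := Nat.ceil_pos.2 (by linarith : 0 < η * w * γ n); omega⟩
  have hmge : η * w * γ n / 2 ≤ m := by
    have h1 := Nat.le_ceil (η * w * γ n)
    rw [hm] at h1
    push_cast at h1
    linarith
  have hexp : v - b * τ * m ≤ -k * w ^ δ := by
    have h1 : c₁ * w ^ (q * δ + 1) ≤ b * τ * m := by
      have e : c₁ * w ^ (q * δ + 1) = b * ((v / 2) ^ q / (c * γ n)) * (η * w * γ n / 2) := by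
        have e' : k * w ^ δ / 2 = k / 2 * w ^ δ := by ring
        rw [hc₁, hv, e', Real.mul_rpow (by positivity) (by positivity),
          Real.rpow_add_one hw0.ne', mul_comm q δ, Real.rpow_mul hw0.le]
        field_simp
      rw [e]
      gcongr
    have h2 : 2 * k * w ^ δ ≤ c₁ * w ^ (q * δ + 1) := by
      rw [div_le_iff₀' hc₁0] at hw3
      calc 2 * k * w ^ δ ≤ c₁ * w ^ (q * δ + 1 - δ) * w ^ δ := by gcongr
        _ = c₁ * w ^ (q * δ + 1) := by rw [mul_assoc, ← Real.rpow_add hw0, sub_add_cancel]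
    rw [hv]
    linarith
  have hsub : {ω : ℕ → E | η * w * γ n ≤ visits a n ω} = {ω | m + 1 ≤ visits a n ω} := by
    ext ω
    change η * w * γ n ≤ visits a n ω ↔ m + 1 ≤ visits a n ω
    rw [← hm, Nat.ceil_le]
  have hone : ∫⁻ ω, affineFun 0 (a.indicator fun _ => ENNReal.ofReal (Real.exp (-u)))
      (aᶜ.indicator fun _ => ENNReal.ofReal (Real.exp (-u))) n ω ∂Pm x ≤ 1 := by
    have := h.prob x
    calc _ ≤ ∫⁻ _, 1 ∂Pm x := lintegral_mono fun ω =>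
          (affineFun_zero_le_exp a hu0.le n ω 0 fun j hj hj0 =>
            absurd hj0 (by simpa using hj.ne')).trans_eq (by simp)
      _ = 1 := by simp
  have hφ : ENNReal.ofReal (1 - b * τ) ≤ ENNReal.ofReal (Real.exp (-(b * τ))) :=
    ENNReal.ofReal_le_ofReal (Real.one_sub_le_exp_neg _)
  rw [hsub]
  refine (h.measure_visits_le ha hu0.le (fun n y hy =>
    (h.lintegral_affineFun_zero_le ha hatom hxa hu0 n hy).trans hφ) n m x).trans ?_
  refine (mul_le_mul' le_rfl hone).trans ?_
  rw [mul_one, ← ENNReal.ofReal_pow (Real.exp_nonneg _), ← Real.exp_nat_mul,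
    ← ENNReal.ofReal_mul (Real.exp_nonneg _), ← Real.exp_add]
  refine ENNReal.ofReal_le_ofReal (Real.exp_le_exp.2 (le_trans (le_of_eq ?_) hexp))
  rw [hu, div_mul_cancel₀ _ hn0.ne']
  ring

/-- Tangent line bound for `s ↦ s ^ δ` at `c`. -/
lemma tangent_le_rpow {s c δ : ℝ} (hs : 0 ≤ s) (hc : 0 < c) (hδ : 1 ≤ δ) :
    δ * c ^ (δ - 1) * s ≤ s ^ δ + (δ - 1) * c ^ δ := by
  have h := one_add_mul_self_le_rpow_one_add (s := s / c - 1)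
    (by have := div_nonneg hs hc.le; linarith) hδ
  rw [add_sub_cancel, Real.div_rpow hs hc.le, le_div_iff₀ (by positivity)] at h
  have e : c ^ δ = c ^ (δ - 1) * c := by rw [← Real.rpow_add_one hc.ne', sub_add_cancel]
  have e2 : (s / c) * c ^ δ = c ^ (δ - 1) * s := by rw [e]; field_simp
  nlinarith

lemma IsChainLaw.exists_absSum_tail_of_few_visits (h : IsChainLaw κ Pm) {a : Set E}
    (ha : MeasurableSet a) (hrec : ∀ x, ∀ᵐ ω ∂Pm x, ∃ n, 0 < n ∧ ω n ∈ a)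
    {f : E → ℝ} (hf : Measurable f) {γ : ℝ → ℝ} {δ l κ₀ : ℝ} (hl : 0 < l) (hκ₀ : 0 ≤ κ₀)
    (hpos : ∀ x, 0 < γ x) (hmono : Monotone γ) (hδ : 1 ≤ δ)
    (hlim : Tendsto (fun n : ℕ => γ n ^ δ / (n : ℝ) ^ (δ - 1)) atTop atTop)
    (hmom : ∀ x, ∫⁻ ω, ENNReal.ofReal (Real.exp
      ((l * ∑ i ∈ Finset.Icc 1 (hitT a ω).toNat, |f (ω i)|) ^ δ)) ∂Pm x ≤
        ENNReal.ofReal (Real.exp κ₀)) {k : ℝ} (hk : 0 < k) :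
    ∃ η > 0, ∃ (w₀ : ℝ) (K : ℕ), ∀ n, K ≤ n → ∀ w, w₀ ≤ w → ∀ x,
      Pm x {ω | visits a n ω ≤ η * w * γ n ∧ w * γ n ≤ absSum f n ω} ≤
        ENNReal.ofReal (Real.exp (-k * w ^ δ)) := by
  have hδ0 : 0 < δ := by linarith
  set r : ℝ := l ^ δ with hr
  have hr0 : 0 < r := by positivity
  set c₀ : ℝ := 1 + 8 * κ₀ / r with hc₀
  have hc₀1 : 1 ≤ c₀ := by rw [hc₀]; have : 0 ≤ 8 * κ₀ / r := by positivity
                           linarith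
  have hc₀r : 8 * κ₀ ≤ r * c₀ ^ δ := by
    have h1 : c₀ ≤ c₀ ^ δ := by
      simpa using Real.rpow_le_rpow_of_exponent_le hc₀1 hδ
    calc 8 * κ₀ ≤ r * c₀ := by rw [hc₀]; field_simp; linarith
      _ ≤ r * c₀ ^ δ := by gcongr
  obtain ⟨K, hK⟩ := eventually_atTop.1 ((hlim.eventually_ge_atTop (4 * k / r)).and
    ((eventually_ge_atTop 1).and
      ((tendsto_natCast_atTop_atTop (R := ℝ)).eventually_ge_atTop (2 * δ))))
  refine ⟨1 / c₀, by positivity, max 1 (2 * δ * c₀ / γ 0), K, fun n hn w hw x => ?_⟩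
  obtain ⟨hD, hn1, hn2⟩ := hK n hn
  have hn0 : (0 : ℝ) < n := by exact_mod_cast hn1
  have hw0 : 0 < w := by linarith [le_max_left 1 (2 * δ * c₀ / γ 0)]
  have hγn := hpos n
  set c : ℝ := max c₀ (w * γ n / n) with hc
  have hcc₀ : c₀ ≤ c := le_max_left _ _
  have hc0 : 0 < c := by linarith
  set m : ℝ := w * γ n / c with hm
  have hcm : w * γ n = c * m := by rw [hm]; field_simp
  have hm2 : 2 * δ ≤ m := by
    rw [hm, le_div_iff₀ hc0]
    rcases le_total c₀ (w * γ n / n) with h1 | h1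
    · rw [hc, max_eq_right h1]
      calc 2 * δ * (w * γ n / n) ≤ n * (w * γ n / n) := by gcongr
        _ = w * γ n := by field_simp
    · rw [hc, max_eq_left h1]
      have h2 : 2 * δ * c₀ / γ 0 ≤ w := (le_max_right _ _).trans hw
      rw [div_le_iff₀ (hpos 0)] at h2
      exact h2.trans (by gcongr; exact hmono hn0.le)
  have hvis : ∀ ω, (visits a n ω : ℝ) ≤ 1 / c₀ * w * γ n → (visits a n ω : ℝ) ≤ m := by
    intro ω hω
    rcases le_total c₀ (w * γ n / n) with h1 | h1
    · rw [hm, hc, max_eq_right h1]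
      have : w * γ n / (w * γ n / n) = n := by field_simp
      rw [this]
      exact_mod_cast visits_le a n ω
    · rw [hm, hc, max_eq_left h1]
      exact hω.trans_eq (by ring)
  set p : ℝ := r * δ * c ^ (δ - 1) with hp
  have hp0 : 0 ≤ p := by positivity
  set L : ℝ := κ₀ + r * (δ - 1) * c ^ δ with hL
  have hL0 : 0 ≤ L := by
    have : 0 ≤ δ - 1 := by linarith
    positivity
  have hexc : ∀ x, ∫⁻ ω, ENNReal.ofReal (Real.exp
      (p * ∑ i ∈ Finset.Icc 1 (hitT a ω).toNat, |f (ω i)|)) ∂Pm x ≤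
        ENNReal.ofReal (Real.exp L) := by
    intro x
    calc _ ≤ ∫⁻ ω, ENNReal.ofReal (Real.exp (r * (δ - 1) * c ^ δ)) * ENNReal.ofReal (Real.exp
          ((l * ∑ i ∈ Finset.Icc 1 (hitT a ω).toNat, |f (ω i)|) ^ δ)) ∂Pm x := by
          refine lintegral_mono fun ω => ?_
          rw [← ENNReal.ofReal_mul (Real.exp_nonneg _), ← Real.exp_add]
          refine ENNReal.ofReal_le_ofReal (Real.exp_le_exp.2 ?_)
          have hs : 0 ≤ ∑ i ∈ Finset.Icc 1 (hitT a ω).toNat, |f (ω i)| :=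
            Finset.sum_nonneg fun _ _ => abs_nonneg _
          rw [Real.mul_rpow hl.le hs]
          have := mul_le_mul_of_nonneg_left (tangent_le_rpow hs hc0 hδ) hr0.le
          rw [hp]
          linarith
      _ ≤ ENNReal.ofReal (Real.exp (r * (δ - 1) * c ^ δ)) * ENNReal.ofReal (Real.exp κ₀) := by
          rw [lintegral_const_mul' _ _ ENNReal.ofReal_ne_top]
          gcongr
          exact hmom x
      _ = ENNReal.ofReal (Real.exp L) := by
          rw [← ENNReal.ofReal_mul (Real.exp_nonneg _), ← Real.exp_add, hL, add_comm]
  have hmark := h.lintegral_exp_absSum_sub_visits_le ha hrec hf hp0 hexc n x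
  have hce : c ^ δ = c ^ (δ - 1) * c := by rw [← Real.rpow_add_one hc0.ne', sub_add_cancel]
  have hexp : L - (p * (w * γ n) - L * m) ≤ -k * w ^ δ := by
    have h1 : p * (w * γ n) = r * δ * c ^ δ * m := by rw [hp, hcm, hce]; ring
    have h2 : w ^ δ * (γ n ^ δ / (n : ℝ) ^ (δ - 1)) ≤ c ^ δ * m := by
      have e1 : w ^ δ * (γ n ^ δ / (n : ℝ) ^ (δ - 1)) =
          (w * γ n / n) ^ (δ - 1) * (w * γ n) := by
        rw [Real.div_rpow (by positivity) hn0.le, ← mul_div_assoc, ← Real.mul_rpow hw0.le hγn.le,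
          div_mul_eq_mul_div, ← Real.rpow_add_one (by positivity), sub_add_cancel]
      have e2 : c ^ δ * m = c ^ (δ - 1) * (w * γ n) := by rw [hcm, hce]; ring
      rw [e1, e2]
      gcongr
      exact le_max_right _ _
    have h3 : 4 * k / r * w ^ δ ≤ c ^ δ * m := by
      refine le_trans ?_ h2
      rw [mul_comm]
      gcongr
    have h4 : k * w ^ δ ≤ r / 4 * (c ^ δ * m) := by
      have := mul_le_mul_of_nonneg_left h3 (by positivity : 0 ≤ r / 4)
      refine le_trans (le_of_eq ?_) this
      field_simp
    have h5 : 8 * κ₀ ≤ r * c ^ δ := hc₀r.trans (by gcongr)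
    have hX : 0 < r * c ^ δ := by positivity
    rw [h1, hL]
    have h6 : κ₀ * (m + 1) ≤ r * c ^ δ / 8 * (2 * m) := by
      gcongr
      · linarith
      · linarith
    have h7 : r * c ^ δ * (δ - 1 - m) ≤ r * c ^ δ * (-(m / 2)) := by
      gcongr
      linarith
    nlinarith
  set s : Set (ℕ → E) :=
    {ω | visits a n ω ≤ 1 / c₀ * w * γ n ∧ w * γ n ≤ absSum f n ω} with hs
  have hlow : ENNReal.ofReal (Real.exp (p * (w * γ n) - L * m)) * Pm x s ≤
      ENNReal.ofReal (Real.exp L) := by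
    refine le_trans ?_ hmark
    have hmeas : AEMeasurable
        (fun ω => ENNReal.ofReal (Real.exp (p * absSum f n ω - L * visits a n ω))) (Pm x) := by
      have h1 := measurable_absSum hf n
      have h2 : Measurable fun ω => (visits a n ω : ℝ) :=
        measurable_from_top.comp (measurable_visits ha n)
      exact ((h1.const_mul p).sub (h2.const_mul L)).exp.ennreal_ofReal.aemeasurable
    refine le_trans ?_ (mul_meas_ge_le_lintegral₀ hmeas
      (ENNReal.ofReal (Real.exp (p * (w * γ n) - L * m))))
    gcongr
    rintro ω ⟨h1, h2⟩
    refine ENNReal.ofReal_le_ofReal (Real.exp_le_exp.2 ?_)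
    have := hvis ω h1
    gcongr
  calc Pm x s = ENNReal.ofReal (Real.exp (-(p * (w * γ n) - L * m))) *
        (ENNReal.ofReal (Real.exp (p * (w * γ n) - L * m)) * Pm x s) := by
        rw [← mul_assoc, ← ENNReal.ofReal_mul (Real.exp_nonneg _), ← Real.exp_add]
        simp
    _ ≤ ENNReal.ofReal (Real.exp (-(p * (w * γ n) - L * m))) * ENNReal.ofReal (Real.exp L) := by
        gcongr
    _ ≤ ENNReal.ofReal (Real.exp (-k * w ^ δ)) := by
        rw [← ENNReal.ofReal_mul (Real.exp_nonneg _), ← Real.exp_add]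
        refine ENNReal.ofReal_le_ofReal (Real.exp_le_exp.2 (le_trans (le_of_eq ?_) hexp))
        ring



/-- The partial sums normalized by `γ n` have tails `exp (-k w ^ δ)` for every `k`, uniformly
in the starting point and in `n` large. -/
lemma IsChainLaw.exists_absSum_tail (h : IsChainLaw κ Pm) {a : Set E}
    (ha : MeasurableSet a) (hatom : ∀ x ∈ a, ∀ y ∈ a, κ x = κ y) {xa : E} (hxa : xa ∈ a)
    (hrec : ∀ x, ∀ᵐ ω ∂Pm x, ∃ n, 0 < n ∧ ω n ∈ a)
    {f : E → ℝ} (hf : Measurable f) {γ : ℝ → ℝ} {α δ l c : ℝ} (hl : 0 < l)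
    (hc : 0 < c) (hpos : ∀ x, 0 < γ x) (hmono : Monotone γ)
    (hγ : ∀ x : ℝ, (c * γ x)⁻¹ =
      (Pm xa {ω | ∀ k : ℕ, 0 < k → (k : ℝ) ≤ x → ω k ∉ a}).toReal)
    (hα0 : 0 < α) (hα1 : α < 1) (hRV : RegVary γ α) (hδ : 1 ≤ δ) (hδα : δ < (1 - α)⁻¹)
    {C : ℝ≥0∞} (hC : C ≠ ⊤) (hmom : ∀ x, ∫⁻ ω, ENNReal.ofReal (Real.exp
      ((l * ∑ i ∈ Finset.Icc 1 (hitT a ω).toNat, |f (ω i)|) ^ δ)) ∂Pm x ≤ C)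
    {k : ℝ} (hk : 0 < k) :
    ∃ (A : ℝ) (K : ℕ), ∀ n, K ≤ n → ∀ w, 0 ≤ w → ∀ x,
      Pm x {ω | w * γ n ≤ absSum f n ω} ≤ ENNReal.ofReal (A * Real.exp (-k * w ^ δ)) := by
  have hδ0 : 0 < δ := by linarith
  obtain ⟨q, hq, hqα⟩ : ∃ q, max 0 (1 - 1 / δ) < q ∧ q < α := by
    refine exists_between (max_lt hα0 ?_)
    rw [lt_inv_comm₀ hδ0 (by linarith)] at hδα
    rw [one_div]
    linarith
  have hq0 : 0 < q := (le_max_left _ _).trans_lt hq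
  have hqδ : δ * (1 - q) < 1 := by
    have : 1 - 1 / δ < q := (le_max_right _ _).trans_lt hq
    rw [mul_comm, ← lt_div_iff₀ hδ0]
    linarith
  obtain ⟨t₀, ht₀, hpot⟩ := hRV.exists_potter_bound hpos hq0 hqα hmono
  have hmom' : ∀ x, ∫⁻ ω, ENNReal.ofReal (Real.exp
      ((l * ∑ i ∈ Finset.Icc 1 (hitT a ω).toNat, |f (ω i)|) ^ δ)) ∂Pm x ≤
        ENNReal.ofReal (Real.exp C.toReal) := by
    refine fun x => (hmom x).trans ?_
    rw [ENNReal.le_ofReal_iff_toReal_le hC (Real.exp_nonneg _)]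
    linarith [Real.add_one_le_exp C.toReal]
  obtain ⟨η, hη, w₁, K₁, h₁⟩ := h.exists_absSum_tail_of_few_visits ha hrec hf hl
    ENNReal.toReal_nonneg hpos hmono hδ
    (tendsto_rpow_div_rpow_atTop hpos hδ hqδ ht₀ hpot) hmom' hk
  obtain ⟨w₂, K₂, h₂⟩ := h.exists_visits_tail ha hatom hxa hc hpos hmono hγ hδ hqδ ht₀ hpot hk hη
  set w₀ : ℝ := max 0 (max w₁ w₂) with hw₀
  have hw₀0 : 0 ≤ w₀ := le_max_left _ _
  refine ⟨2 + Real.exp (k * w₀ ^ δ), max K₁ K₂, fun n hn w hw x => ?_⟩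
  have := h.prob x
  rcases le_total w₀ w with hle | hle
  · have hle₁ : w₁ ≤ w := ((le_max_left _ _).trans (le_max_right _ _)).trans hle
    have hle₂ : w₂ ≤ w := ((le_max_right _ _).trans (le_max_right _ _)).trans hle
    calc Pm x {ω | w * γ n ≤ absSum f n ω}
        ≤ Pm x ({ω | visits a n ω ≤ η * w * γ n ∧ w * γ n ≤ absSum f n ω} ∪
            {ω | η * w * γ n ≤ visits a n ω}) := by
          refine measure_mono fun ω hω => ?_
          rcases le_total (visits a n ω : ℝ) (η * w * γ n) with h3 | h3
          · exact Or.inl ⟨h3, hω⟩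
          · exact Or.inr h3
      _ ≤ ENNReal.ofReal (Real.exp (-k * w ^ δ)) + ENNReal.ofReal (Real.exp (-k * w ^ δ)) :=
          (measure_union_le _ _).trans (add_le_add
            (h₁ n ((le_max_left _ _).trans hn) w hle₁ x)
            (h₂ n ((le_max_right _ _).trans hn) w hle₂ x))
      _ ≤ ENNReal.ofReal ((2 + Real.exp (k * w₀ ^ δ)) * Real.exp (-k * w ^ δ)) := by
          rw [← ENNReal.ofReal_add (Real.exp_nonneg _) (Real.exp_nonneg _)]
          refine ENNReal.ofReal_le_ofReal ?_
          have := mul_pos (Real.exp_pos (k * w₀ ^ δ)) (Real.exp_pos (-k * w ^ δ))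
          linarith
  · refine prob_le_one.trans ?_
    rw [← ENNReal.ofReal_one]
    refine ENNReal.ofReal_le_ofReal ?_
    have h3 : k * w ^ δ ≤ k * w₀ ^ δ := by gcongr
    have h4 : 1 ≤ Real.exp (k * w₀ ^ δ) * Real.exp (-k * w ^ δ) := by
      rw [← Real.exp_add]
      exact Real.one_le_exp (by linarith)
    have := Real.exp_pos (-k * w ^ δ)
    nlinarith

end Tail

/-! ### The cumulant -/

lemma continuous_trunc : Continuous trunc :=
  continuous_id.div (continuous_abs.max continuous_const) fun z =>
    (lt_of_lt_of_le one_pos (le_max_right |z| 1)).ne'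

lemma abs_exp_sub_one_sub_le (x : ℝ) : |Real.exp x - 1 - x| ≤ x ^ 2 * Real.exp |x| := by
  rw [abs_of_nonneg (by linarith [Real.add_one_le_exp x])]
  have h1 : Real.exp x - 1 ≤ x * Real.exp x := by
    have := mul_le_mul_of_nonneg_left (Real.one_sub_le_exp_neg x) (Real.exp_nonneg x)
    rw [← Real.exp_add, add_neg_cancel, Real.exp_zero] at this
    linarith
  rcases le_total 0 x with hx | hx
  · rw [abs_of_nonneg hx]
    nlinarith
  · have h2 : 1 ≤ Real.exp |x| := Real.one_le_exp (abs_nonneg x)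
    have h3 := Real.add_one_le_exp x
    nlinarith [sq_nonneg x]

lemma continuous_cumulant {ρ : Measure ℝ}
    (hρ2 : (∫⁻ z, ENNReal.ofReal (trunc z ^ 2) ∂ρ) ≠ ⊤)
    (hρexp : ∀ l : ℝ, (∫⁻ z in {z : ℝ | 1 < |z|}, ENNReal.ofReal (Real.exp (l * z)) ∂ρ) ≠ ⊤) :
    Continuous (cumulant ρ) := by
  have hms : MeasurableSet {z : ℝ | 1 < |z|} := measurableSet_lt measurable_const measurable_norm
  have hi2 : Integrable (fun z => trunc z ^ 2) ρ :=
    ⟨(continuous_trunc.pow 2).aestronglyMeasurable, by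
      rw [hasFiniteIntegral_iff_ofReal (Eventually.of_forall fun z => sq_nonneg _)]
      exact hρ2.lt_top⟩
  have hiexp : ∀ l : ℝ, Integrable ({z : ℝ | 1 < |z|}.indicator fun z => Real.exp (l * z)) ρ := by
    intro l
    rw [integrable_indicator_iff hms]
    refine ⟨(by fun_prop : Continuous fun z : ℝ => Real.exp (l * z)).aestronglyMeasurable, ?_⟩
    rw [hasFiniteIntegral_iff_ofReal (Eventually.of_forall fun z => Real.exp_nonneg _)]
    exact (hρexp l).lt_top
  rw [continuous_iff_continuousAt]
  intro l₀
  set B : ℝ := |l₀| + 1 with hB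
  have hB0 : 0 ≤ B := by positivity
  refine continuousAt_of_dominated
    (bound := fun z => (B ^ 2 * Real.exp B + 1 + B) * trunc z ^ 2 +
      ({z : ℝ | 1 < |z|}.indicator (fun z => Real.exp (B * z)) z +
        {z : ℝ | 1 < |z|}.indicator (fun z => Real.exp (-B * z)) z)) ?_ ?_
    ((hi2.const_mul _).add ((hiexp B).add (hiexp (-B)))) ?_
  · refine Eventually.of_forall fun l => Continuous.aestronglyMeasurable ?_
    have := continuous_trunc
    fun_prop
  · have hball : ∀ᶠ l in 𝓝 l₀, |l| ≤ B := by
      have : ∀ᶠ l in 𝓝 l₀, |l| < B :=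
        continuous_abs.continuousAt.eventually (eventually_lt_nhds (by rw [hB]; linarith))
      exact this.mono fun l hl => hl.le
    filter_upwards [hball] with l hl
    refine Eventually.of_forall fun z => ?_
    rw [Real.norm_eq_abs]
    by_cases hz : 1 < |z|
    · rw [indicator_of_mem (show z ∈ {z : ℝ | 1 < |z|} from hz),
        indicator_of_mem (show z ∈ {z : ℝ | 1 < |z|} from hz)]
      have ht : |trunc z| = 1 := by
        rw [trunc, max_eq_left hz.le, abs_div, abs_abs, div_self (by linarith)]
      have ht2 : trunc z ^ 2 = 1 := by rw [← sq_abs, ht, one_pow]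
      have h1 : Real.exp (l * z) ≤ Real.exp (B * z) + Real.exp (-B * z) := by
        have h2 : l * z ≤ B * |z| := by
          refine (le_abs_self _).trans ?_
          rw [abs_mul]
          gcongr
        refine (Real.exp_le_exp.2 h2).trans ?_
        rcases abs_cases z with ⟨h3, _⟩ | ⟨h3, _⟩
        · rw [h3]; linarith [Real.exp_pos (-B * z)]
        · rw [h3, mul_neg, ← neg_mul]; linarith [Real.exp_pos (B * z)]
      have h2 : |l * trunc z| ≤ B := by rw [abs_mul, ht, mul_one]; exact hl
      have h3 := abs_le.1 h2
      have h4 := Real.exp_pos (l * z)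
      have h5 : 0 ≤ B ^ 2 * Real.exp B := by positivity
      rw [ht2, abs_le]
      constructor <;> linarith
    · rw [indicator_of_notMem (show z ∉ {z : ℝ | 1 < |z|} from hz),
        indicator_of_notMem (show z ∉ {z : ℝ | 1 < |z|} from hz), add_zero, add_zero]
      push Not at hz
      have ht : trunc z = z := by rw [trunc, max_eq_right hz, div_one]
      rw [ht]
      refine (abs_exp_sub_one_sub_le (l * z)).trans ?_
      have h1 : |l * z| ≤ B := by
        rw [abs_mul]
        exact (mul_le_of_le_one_right (abs_nonneg l) hz).trans hl
      have h2 : l ^ 2 ≤ B ^ 2 := sq_le_sq' (abs_le.1 hl).1 (abs_le.1 hl).2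
      calc (l * z) ^ 2 * Real.exp |l * z| = l ^ 2 * Real.exp |l * z| * z ^ 2 := by ring
        _ ≤ B ^ 2 * Real.exp B * z ^ 2 := by gcongr
        _ ≤ (B ^ 2 * Real.exp B + 1 + B) * z ^ 2 := by gcongr; linarith
  · exact Eventually.of_forall fun z => by fun_prop

lemma cumulant_zero (ρ : Measure ℝ) : cumulant ρ 0 = 0 := by simp [cumulant]

lemma exists_cumulant_eq {ρ : Measure ℝ} (hcont : Continuous (cumulant ρ)) {s t : ℝ}
    (ht : 0 ≤ t) (hs : t ≤ cumulant ρ s) : ∃ s', |s'| ≤ |s| ∧ cumulant ρ s' = t := by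
  have h := intermediate_value_uIcc (a := 0) (b := s) hcont.continuousOn
  rw [cumulant_zero] at h
  obtain ⟨s', hs', e⟩ := h (Set.mem_uIcc.2 (Or.inl ⟨ht, hs⟩))
  refine ⟨s', ?_, e⟩
  simpa using Set.abs_sub_left_of_mem_uIcc hs'

lemma gbar_le_abs {ρ : Measure ℝ} (hcont : Continuous (cumulant ρ)) {s t : ℝ}
    (ht : 0 ≤ t) (hs : t ≤ cumulant ρ s) : gbar ρ t ≤ |s| := by
  obtain ⟨s', hs', e⟩ := exists_cumulant_eq hcont ht hs
  have hb : BddBelow {y : ℝ | ∃ s : ℝ, |s| = y ∧ cumulant ρ s = t} :=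
    ⟨0, by rintro _ ⟨s, rfl, _⟩; exact abs_nonneg s⟩
  exact (csInf_le hb ⟨s', rfl, e⟩).trans hs'

lemma gbar_nonneg (ρ : Measure ℝ) (t : ℝ) : 0 ≤ gbar ρ t :=
  Real.sInf_nonneg (by rintro _ ⟨s, rfl, _⟩; exact abs_nonneg s)

lemma monotone_gbar_max {ρ : Measure ℝ} (hcont : Continuous (cumulant ρ))
    (hunb : ∀ t, ∃ s, t ≤ cumulant ρ s) : Monotone fun t => gbar ρ (max t 0) := by
  intro t t' htt'
  have ht' : 0 ≤ max t' 0 := le_max_right _ _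
  obtain ⟨s, hs⟩ := hunb (max t' 0)
  obtain ⟨s', -, hs'⟩ := exists_cumulant_eq hcont ht' hs
  refine le_csInf ⟨|s'|, s', rfl, hs'⟩ ?_
  rintro _ ⟨y, rfl, hy⟩
  exact gbar_le_abs hcont (le_max_right _ _) ((max_le_max_right 0 htt').trans hy.ge)

/-- Truncated expectations of `g(S)` are controlled by tail bounds for `|S|` and the
integrability of `t ↦ exp (-k ḡ(t) ^ δ)`. -/
lemma integral_indicator_cumulant_le {Ω : Type*} [MeasurableSpace Ω] {P : Measure Ω}
    [SFinite P] {ρ : Measure ℝ} (hcont : Continuous (cumulant ρ))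
    (hunb : ∀ t, ∃ s, t ≤ cumulant ρ s) {S R : Ω → ℝ} (hR : Measurable R) (hSR : ∀ ω, |S ω| ≤ R ω)
    {A k δ : ℝ} (htail : ∀ w, 0 ≤ w → P {ω | w ≤ R ω} ≤ ENNReal.ofReal (A * Real.exp (-k * w ^ δ)))
    {N : ℝ} (hN : 0 ≤ N)
    (hfin : ∫⁻ t in Ioi (N / 2), ENNReal.ofReal (Real.exp (-k * gbar ρ t ^ δ)) ≠ ⊤) :
    ∫ ω, {ω' | N ≤ cumulant ρ (S ω')}.indicator (fun ω' => cumulant ρ (S ω')) ω ∂P ≤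
      (2 * (ENNReal.ofReal A *
        ∫⁻ t in Ioi (N / 2), ENNReal.ofReal (Real.exp (-k * gbar ρ t ^ δ)))).toReal := by
  set F : Ω → ℝ := {ω' | N ≤ cumulant ρ (S ω')}.indicator fun ω' => cumulant ρ (S ω') with hF
  have hF0 : ∀ ω, 0 ≤ F ω := fun ω => indicator_nonneg (fun ω' h => hN.trans h) ω
  by_cases hint : Integrable F P
  swap
  · rw [integral_undef hint]; exact ENNReal.toReal_nonneg
  rw [integral_eq_lintegral_of_nonneg_ae (Eventually.of_forall hF0) hint.1]
  refine ENNReal.toReal_mono (ENNReal.mul_ne_top (by simp)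
    (ENNReal.mul_ne_top ENNReal.ofReal_ne_top hfin)) ?_
  set D : Set (Ω × ℝ) := {z | gbar ρ (max z.2 0) ≤ R z.1} with hD
  have hDm : MeasurableSet D := measurableSet_le
    ((monotone_gbar_max hcont hunb).measurable.comp measurable_snd) (hR.comp measurable_fst)
  have hpt : ∀ ω, ENNReal.ofReal (F ω) ≤
      2 * ∫⁻ t in Ioi (N / 2), D.indicator 1 (ω, t) := by
    intro ω
    by_cases hω : N ≤ cumulant ρ (S ω)
    · have e : F ω = cumulant ρ (S ω) := indicator_of_mem (by exact hω) _
      set G := cumulant ρ (S ω) with hG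
      have h1 : ENNReal.ofReal (G - N / 2) ≤ ∫⁻ t in Ioi (N / 2), D.indicator 1 (ω, t) := by
        calc ENNReal.ofReal (G - N / 2) = ∫⁻ _ in Ioc (N / 2) G, 1 := by simp
          _ ≤ ∫⁻ t in Ioc (N / 2) G, D.indicator 1 (ω, t) := by
              refine setLIntegral_mono' measurableSet_Ioc fun t ht => ?_
              have ht0 : 0 ≤ t := by have := ht.1; linarith
              have hmem : (ω, t) ∈ D := by
                change gbar ρ (max t 0) ≤ R ω
                rw [max_eq_left ht0]
                exact (gbar_le_abs hcont ht0 ht.2).trans (hSR ω)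
              rw [indicator_of_mem hmem, Pi.one_apply]
          _ ≤ _ := lintegral_mono_set fun t ht => ht.1
      calc ENNReal.ofReal (F ω) ≤ ENNReal.ofReal (2 * (G - N / 2)) :=
            ENNReal.ofReal_le_ofReal (by rw [e]; linarith)
        _ = 2 * ENNReal.ofReal (G - N / 2) := by rw [ENNReal.ofReal_mul zero_le_two]; simp
        _ ≤ _ := by gcongr
    · have e : F ω = 0 := indicator_of_notMem (by exact hω) _
      rw [e, ENNReal.ofReal_zero]
      exact zero_le
  have hm : Measurable fun z : Ω × ℝ => D.indicator (1 : Ω × ℝ → ℝ≥0∞) z :=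
    measurable_one.indicator hDm
  calc ∫⁻ ω, ENNReal.ofReal (F ω) ∂P
      ≤ ∫⁻ ω, 2 * (∫⁻ t in Ioi (N / 2), D.indicator 1 (ω, t)) ∂P := lintegral_mono hpt
    _ = 2 * ∫⁻ ω, (∫⁻ t in Ioi (N / 2), D.indicator 1 (ω, t)) ∂P := by
        rw [lintegral_const_mul' _ _ (by simp)]
    _ = 2 * ∫⁻ t in Ioi (N / 2), ∫⁻ ω, D.indicator 1 (ω, t) ∂P := by
        rw [lintegral_lintegral_swap]
        exact hm.aemeasurable
    _ ≤ 2 * ∫⁻ t in Ioi (N / 2),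
          ENNReal.ofReal A * ENNReal.ofReal (Real.exp (-k * gbar ρ t ^ δ)) := by
        gcongr 2 * ?_
        refine setLIntegral_mono' measurableSet_Ioi fun t ht => ?_
        have ht0 : 0 ≤ t := by have : N / 2 < t := ht; linarith
        have e : (fun ω => D.indicator (1 : Ω × ℝ → ℝ≥0∞) (ω, t)) =
            {ω | gbar ρ t ≤ R ω}.indicator 1 := by
          funext ω
          simp only [hD, indicator, mem_ofPred_eq, max_eq_left ht0]
          rfl
        rw [e, lintegral_indicator_one (measurableSet_le measurable_const hR)]
        refine (htail _ (gbar_nonneg ρ t)).trans_eq ?_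
        rw [ENNReal.ofReal_mul' (Real.exp_nonneg _)]
    _ = _ := by rw [lintegral_const_mul' _ _ ENNReal.ofReal_ne_top]

/-- Tails of a convergent integral over a half-line vanish. -/
lemma tendsto_lintegral_Ioi_atTop {F : ℝ → ℝ≥0∞} (hF : ∫⁻ t in Ioi (0 : ℝ), F t ≠ ⊤) :
    Tendsto (fun N : ℝ => ∫⁻ t in Ioi N, F t) atTop (𝓝 0) := by
  have h := tendsto_measure_iInter_atTop (μ := volume.withDensity F) (s := fun N : ℝ => Ioi N)
    (fun N => measurableSet_Ioi.nullMeasurableSet) (fun _ _ h => Ioi_subset_Ioi h)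
    ⟨0, by rwa [withDensity_apply _ measurableSet_Ioi]⟩
  have e : ⋂ N : ℝ, Ioi N = ∅ := by
    refine eq_empty_of_forall_notMem fun x hx => ?_
    exact lt_irrefl x (mem_iInter.1 hx x)
  rw [e, measure_empty] at h
  refine h.congr fun N => ?_
  rw [Function.comp_apply, withDensity_apply _ measurableSet_Ioi]


/-! ### The normalizing function and the block sums -/

lemma RegVary.tail_pos {τ : ℝ → ℝ} (hτ : Antitone τ) (hτ0 : ∀ x, 0 ≤ τ x) {γ : ℝ → ℝ}
    {c α : ℝ} (hγ : ∀ x, γ x = (c * τ x)⁻¹) (hRV : RegVary γ α) (x : ℝ) : 0 < τ x := by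
  by_contra! hx
  have h0 : ∀ᶠ t in atTop, γ (t * 2) / γ t = 0 := by
    filter_upwards [eventually_ge_atTop x] with t ht
    have : τ t = 0 := le_antisymm ((hτ ht).trans hx) (hτ0 t)
    simp [hγ t, this]
  have h1 := tendsto_nhds_unique (hRV 2 two_pos)
    (tendsto_const_nhds.congr' (h0.mono fun _ h => h.symm))
  have h2 : (0 : ℝ) < 2 ^ α := by positivity
  linarith

lemma abs_sum_blocks_le {E : Type*} (f : E → ℝ) {J : ℕ} {t : ℕ → ℝ} (ht : ∀ i ≤ J, t i ≤ 1)
    (v : ℕ → ℝ) (n : ℕ) (ω : ℕ → E) :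
    |∑ i ∈ Finset.Icc 1 J, v i * ∑ k ∈ Finset.Ioc ⌊(n : ℝ) * t (i - 1)⌋₊ ⌊(n : ℝ) * t i⌋₊, f (ω k)|
      ≤ (1 + ∑ i ∈ Finset.Icc 1 J, |v i|) * absSum f n ω := by
  refine (Finset.abs_sum_le_sum_abs _ _).trans ?_
  have hnn := absSum_nonneg f n ω
  have key : ∑ i ∈ Finset.Icc 1 J,
      |v i * ∑ k ∈ Finset.Ioc ⌊(n : ℝ) * t (i - 1)⌋₊ ⌊(n : ℝ) * t i⌋₊, f (ω k)| ≤
        ∑ i ∈ Finset.Icc 1 J, |v i| * absSum f n ω := by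
    refine Finset.sum_le_sum fun i hi => ?_
    rw [abs_mul]
    refine mul_le_mul_of_nonneg_left ?_ (abs_nonneg _)
    refine (Finset.abs_sum_le_sum_abs _ _).trans ?_
    rw [← sum_Icc_one_eq_absSum]
    refine Finset.sum_le_sum_of_subset_of_nonneg (fun k hk => ?_) fun _ _ _ => abs_nonneg _
    rw [Finset.mem_Ioc] at hk
    have hle : ⌊(n : ℝ) * t i⌋₊ ≤ n := by
      refine Nat.floor_le_of_le ?_
      exact mul_le_of_le_one_right (Nat.cast_nonneg n) (ht i (Finset.mem_Icc.1 hi).2)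
    exact Finset.mem_Icc.2 ⟨by omega, by omega⟩
  rw [← Finset.sum_mul] at key
  linarith

/-- **Lemma 5.6 (Uniform integrability).** -/
theorem uniform_integrability
    /- the state space and the Markov kernel -/
    {E : Type*} [MeasurableSpace E] (κ : Kernel E E) [IsMarkovKernel κ]
    (π : Measure E) [SigmaFinite π]
    (hinv : Measure.bind π (fun x => κ x) = π)
    (hnull : π Set.univ = ⊤)
    /- the laws `P_x` of the chain started at `x` -/
    (Pm : E → Measure (ℕ → E)) (hPmProb : ∀ x, IsProbabilityMeasure (Pm x))
    (hstart : ∀ x, Pm x {ω | ω 0 = x} = 1)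
    (hmarkov : ∀ (x : E) (k : ℕ) (A : ℕ → Set E), (∀ i, MeasurableSet (A i)) →
      Pm x {ω | ∀ i < k, ω (i + 1) ∈ A i} = stepProb κ A k x)
    /- irreducibility and Harris recurrence -/
    (hHarris : ∀ A : Set E, MeasurableSet A → 0 < π A → ∀ x,
      Pm x {ω | ∀ N : ℕ, ∃ n ≥ N, ω n ∈ A} = 1)
    /- the atom -/
    (a : Set E) (hameas : MeasurableSet a) (hπa : 0 < π a) (hπafin : π a ≠ ⊤)
    (hatom : ∀ x ∈ a, ∀ y ∈ a, κ x = κ y) (xa : E) (hxa : xa ∈ a)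
    /- `γ(x) = (π(a) P_a[T > x])⁻¹` is regularly varying of index `α ∈ (0,1)` -/
    (γ : ℝ → ℝ) (α : ℝ) (hα0 : 0 < α) (hα1 : α < 1)
    (hγdef : ∀ x : ℝ, γ x =
      ((π a).toReal * (Pm xa {ω | ∀ n : ℕ, 0 < n → (n : ℝ) ≤ x → ω n ∉ a}).toReal)⁻¹)
    (hγRV : RegVary γ α)
    /- the partition `(E_n)` of `E` -/
    (Epart : ℕ → Set E) (hEmeas : ∀ n, MeasurableSet (Epart n))
    (hEdisj : Pairwise fun i j => Disjoint (Epart i) (Epart j))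
    (hEcover : (⋃ n, Epart n) = Set.univ)
    (hEfin : ∀ n, π (Epart n) ≠ ⊤) (hEpos : ∀ n, 0 < π (Epart n))
    /- `ψ ∈ RV_β` monotone, and `P_{π_n}[T/ψ(n) ∈ ·] ⇒ Q` -/
    (ψf : ℝ → ℝ) (β : ℝ) (hβ : 0 < β) (hψmono : Monotone ψf) (hψRV : RegVary ψf β)
    (Q : Measure ℝ) [IsProbabilityMeasure Q]
    (hQweak : ∀ F : ℝ →ᵇ ℝ, Tendsto
      (fun n : ℕ => ∫ ω, F (hitTr a ω / ψf n) ∂(Ppart π Epart Pm n)) atTop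
      (nhds (∫ x, F x ∂Q)))
    /- `π(E_{[rn]})/π(E_n) → r^ζ` -/
    (ζ : ℝ) (hζ : -1 < ζ)
    (hπreg : ∀ r : ℝ, 0 < r → Tendsto
      (fun n : ℕ => (π (Epart ⌊r * (n : ℝ)⌋₊)).toReal / (π (Epart n)).toReal) atTop
      (nhds (r ^ ζ)))
    /- condition (eq:Qassmp) -/
    (hQasmp : ∃ ε' > (0:ℝ), ∃ c > (0:ℝ), ∃ N : ℝ, 1 < N ∧ ∃ k > (0:ℝ), ∃ ε > (0:ℝ),
      ∀ r : ℝ, 1 ≤ r → ∀ n : ℕ, N * r ≤ (n : ℝ) →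
        (Ppart π Epart Pm n {ω | hitTr a ω / ψf n ≤ c * r ^ (-β + ε')}).toReal
          < k * r ^ (-ζ - 1 - ε))
    /- the Lévy measure `ρ` with exponential moments -/
    (ρ : Measure ℝ) (hρ0 : ρ {0} = 0)
    (hρ2 : (∫⁻ z, ENNReal.ofReal (trunc z ^ 2) ∂ρ) ≠ ⊤)
    (hρexp : ∀ l : ℝ, (∫⁻ z in {z : ℝ | 1 < |z|}, ENNReal.ofReal (Real.exp (l * z)) ∂ρ) ≠ ⊤)
    /- the function `f` -/
    (f : E → ℝ) (hfmeas : Measurable f)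
    /- condition (eq:fassmp) -/
    (hfassmp : ∀ l : ℝ, 0 < l → ∃ k > (0:ℝ), ∃ N : ℝ, 1 < N ∧ ∃ ε > (0:ℝ),
      ∀ r : ℝ, 1 ≤ r → ∀ n : ℕ, N * r ≤ (n : ℝ) →
        (∫ ω, cumulant ρ
            (l * ∑ i ∈ Finset.Icc 1 ((hitT a ω ⊓ ((⌊ψf ((n : ℝ) / r)⌋₊ : ℕ∞))).toNat),
              |f (ω i)|) ∂(Ppart π Epart Pm n))
          ≤ k * r ^ (-ζ - 1 - ε))
    /- Assumption 4.1 -/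
    (δ : ℝ) (hδ1 : 1 ≤ δ) (hδ2 : δ < (1 - α)⁻¹)
    (hgint : ∃ k₀ > (0:ℝ),
      (∫⁻ t in Set.Ioi (0:ℝ), ENNReal.ofReal (Real.exp (-k₀ * gbar ρ t ^ δ))) ≠ ⊤)
    (hmom : ∃ l > (0:ℝ), ∃ C : ℝ≥0∞, C ≠ ⊤ ∧ ∀ x : E,
      (∫⁻ ω, ENNReal.ofReal
          (Real.exp ((l * ∑ i ∈ Finset.Icc 1 (hitT a ω).toNat, |f (ω i)|) ^ δ))
        ∂(Pm x)) ≤ C)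
    /- the two cases for the normalization `c_n` -/
    (cseq : ℕ → ℝ)
    (hcase : ((∀ n, cseq n = 1) ∧
        (∀ l : ℝ, ∃ C : ℝ≥0∞, C ≠ ⊤ ∧ ∀ x : E,
          (∫⁻ ω, ENNReal.ofReal
              (Real.exp ((l * ∑ i ∈ Finset.Icc 1 (hitT a ω).toNat, |f (ω i)|) ^ δ))
            ∂(Pm x)) ≤ C)) ∨
      Tendsto cseq atTop atTop)
    /- the time points `0 = t_0 < t_1 < ⋯ < t_{|j|} ≤ 1` and coefficients -/
    (J : ℕ) (hJ : 0 < J) (tj : ℕ → ℝ) (ht0 : tj 0 = 0)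
    (htmono : ∀ i < J, tj i < tj (i + 1)) (htle : tj J ≤ 1) (lv : ℕ → ℝ) :
    ∃ K : ℕ, 1 ≤ K ∧ ∀ ε : ℝ, 0 < ε → ∃ N₀ : ℝ, ∀ N : ℝ, N₀ ≤ N →
      ∀ (x : E) (n : ℕ), K ≤ n →
        (∫ ω, Set.indicator
            {ω' : ℕ → E | N ≤ cumulant ρ ((γ (n : ℝ) * cseq n)⁻¹ *
              ∑ i ∈ Finset.Icc 1 J, lv i *
                ∑ k ∈ Finset.Ioc ⌊(n : ℝ) * tj (i - 1)⌋₊ ⌊(n : ℝ) * tj i⌋₊, f (ω' k))}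
            (fun ω' => cumulant ρ ((γ (n : ℝ) * cseq n)⁻¹ *
              ∑ i ∈ Finset.Icc 1 J, lv i *
                ∑ k ∈ Finset.Ioc ⌊(n : ℝ) * tj (i - 1)⌋₊ ⌊(n : ℝ) * tj i⌋₊, f (ω' k)))
            ω ∂(Pm x))
          ≤ ε := by
  have h : IsChainLaw κ Pm := ⟨hPmProb, hstart, hmarkov⟩
  have hrec : ∀ x, ∀ᵐ ω ∂Pm x, ∃ n, 0 < n ∧ ω n ∈ a := by
    intro x
    have hm : MeasurableSet {ω : ℕ → E | ∀ N : ℕ, ∃ n ≥ N, ω n ∈ a} := by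
      have e : {ω : ℕ → E | ∀ N : ℕ, ∃ n ≥ N, ω n ∈ a} =
          ⋂ N : ℕ, ⋃ n : ℕ, ⋃ _ : n ≥ N, (fun ω : ℕ → E => ω n) ⁻¹' a := by
        ext ω; simp
      rw [e]
      exact MeasurableSet.iInter fun N => MeasurableSet.iUnion fun n =>
        MeasurableSet.iUnion fun _ => measurable_pi_apply n hameas
    have hae : ∀ᵐ ω ∂Pm x, ∀ N : ℕ, ∃ n ≥ N, ω n ∈ a :=
      (mem_ae_iff_prob_eq_one hm).2 (hHarris a hameas hπa x)
    filter_upwards [hae] with ω hω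
    obtain ⟨n, hn, hωn⟩ := hω 1
    exact ⟨n, hn, hωn⟩
  set c : ℝ := (π a).toReal with hc
  have hc0 : 0 < c := ENNReal.toReal_pos hπa.ne' hπafin
  set τ : ℝ → ℝ := fun x => (Pm xa {ω | ∀ n : ℕ, 0 < n → (n : ℝ) ≤ x → ω n ∉ a}).toReal with hτ
  have hτanti : Antitone τ := fun x y hxy => ENNReal.toReal_mono (measure_ne_top _ _)
    (measure_mono fun ω hω n hn hnx => hω n hn (hnx.trans hxy))
  have hτpos : ∀ x, 0 < τ x :=
    hγRV.tail_pos hτanti (fun x => ENNReal.toReal_nonneg) hγdef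
  have hγpos : ∀ x, 0 < γ x := fun x => by
    rw [hγdef x]; exact inv_pos.2 (mul_pos hc0 (hτpos x))
  have hγmono : Monotone γ := fun x y hxy => by
    rw [hγdef x, hγdef y]
    exact inv_anti₀ (mul_pos hc0 (hτpos y)) (mul_le_mul_of_nonneg_left (hτanti hxy) hc0.le)
  have hγτ : ∀ x, (c * γ x)⁻¹ = τ x := fun x => by
    rw [hγdef x]
    change (c * (c * τ x)⁻¹)⁻¹ = τ x
    have := (hτpos x).ne'
    field_simp
  obtain ⟨k₀, hk₀, hfin⟩ := hgint
  obtain ⟨l, hl, C, hC, hmomC⟩ := hmom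
  set Λ : ℝ := 1 + ∑ i ∈ Finset.Icc 1 J, |lv i| with hΛ
  have hΛ0 : 0 < Λ := by
    have : 0 ≤ ∑ i ∈ Finset.Icc 1 J, |lv i| := Finset.sum_nonneg fun _ _ => abs_nonneg _
    linarith
  obtain ⟨A, K₁, hA⟩ := h.exists_absSum_tail hameas hatom hxa hrec hfmeas hl hc0 hγpos hγmono hγτ
    hα0 hα1 hγRV hδ1 hδ2 hC hmomC (mul_pos hk₀ (Real.rpow_pos_of_pos hΛ0 δ))
  obtain ⟨K₂, hK₂⟩ : ∃ K₂ : ℕ, ∀ n ≥ K₂, 1 ≤ cseq n := by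
    rcases hcase with ⟨h1, -⟩ | h1
    · exact ⟨0, fun n _ => (h1 n).ge⟩
    · exact eventually_atTop.1 (h1.eventually_ge_atTop 1)
  have htj : ∀ i ≤ J, tj i ≤ 1 := fun i hi =>
    (Nat.decreasingInduction' (P := fun i => tj i ≤ 1)
      (fun i hi _ ih => (htmono i hi).le.trans ih) hi htle)
  refine ⟨max 1 (max K₁ K₂), le_max_left _ _, fun ε hε => ?_⟩
  by_cases hunb : ∀ t, ∃ s, t ≤ cumulant ρ s
  swap
  · push Not at hunb
    obtain ⟨t, ht⟩ := hunb
    refine ⟨t, fun N hN x n _ => ?_⟩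
    refine (integral_eq_zero_of_ae ?_).trans_le hε.le
    refine Eventually.of_forall fun ω => indicator_of_notMem (fun hω => ?_) _
    exact ((ht _).trans_le hN).not_ge hω
  have hlim : Tendsto (fun N : ℝ => (2 * (ENNReal.ofReal A *
      ∫⁻ t in Ioi (N / 2), ENNReal.ofReal (Real.exp (-k₀ * gbar ρ t ^ δ)))).toReal) atTop
      (𝓝 0) := by
    have h1 := (tendsto_lintegral_Ioi_atTop hfin).comp
      (tendsto_id.atTop_div_const (zero_lt_two' ℝ))
    have h2 := ENNReal.Tendsto.const_mul (ENNReal.Tendsto.const_mul h1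
      (Or.inr (ENNReal.ofReal_ne_top (r := A)))) (Or.inr (ENNReal.ofNat_ne_top (n := 2)))
    rw [mul_zero, mul_zero] at h2
    exact (ENNReal.tendsto_toReal ENNReal.zero_ne_top).comp h2
  obtain ⟨N₀, hN₀⟩ := eventually_atTop.1
    ((hlim.eventually_le_const hε).and (eventually_ge_atTop 0))
  refine ⟨N₀, fun N hN x n hn => ?_⟩
  obtain ⟨hNε, hN0⟩ := hN₀ N hN
  have hn₁ : K₁ ≤ n := ((le_max_left _ _).trans (le_max_right _ _)).trans hn
  have hcn : 1 ≤ cseq n := hK₂ n (((le_max_right _ _).trans (le_max_right _ _)).trans hn)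
  have hγn := hγpos n
  have := hPmProb x
  refine (integral_indicator_cumulant_le (R := fun ω => Λ * absSum f n ω / γ n)
    (continuous_cumulant hρ2 hρexp) hunb (((measurable_absSum hfmeas n).const_mul Λ).div_const _)
    (fun ω => ?_) (fun w hw => ?_) hN0
    (ne_top_of_le_ne_top hfin (lintegral_mono_set (Ioi_subset_Ioi (by positivity))))).trans hNε
  · rw [abs_mul, abs_inv, abs_of_pos (mul_pos hγn (by linarith)), inv_mul_eq_div]
    have hnn := absSum_nonneg f n ω
    exact div_le_div₀ (by positivity) (abs_sum_blocks_le f htj lv n ω) hγn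
      (le_mul_of_one_le_right hγn.le hcn)
  · have e : -(k₀ * Λ ^ δ) * (w / Λ) ^ δ = -k₀ * w ^ δ := by
      rw [Real.div_rpow hw hΛ0.le]
      have := (Real.rpow_pos_of_pos hΛ0 δ).ne'
      field_simp
    rw [← e]
    refine le_trans (measure_mono fun ω hω => ?_) (hA n hn₁ (w / Λ) (by positivity) x)
    have hω' : w ≤ Λ * absSum f n ω / γ n := hω
    rw [le_div_iff₀ hγn] at hω'
    change w / Λ * γ n ≤ absSum f n ω
    rwa [div_mul_eq_mul_div, div_le_iff₀' hΛ0]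
end
end

section
/- Example 6.2, null recurrence and invariant measure. Let (Z_n) be the Markov chain on ℤ₊ with transition probabilities P(i,i+1) = p_i q_i and P(i,0) = p_i(1−q_i) for i ≠ 0, P(i,i) = 1−p_i, P(0,1) = 1 (with p_0 = q_0 = 1), where p_n = (n+1)^{−s} and q_n = (n/(n+1))^t for n ≥ 1, with s > 0, t > 0 and 1/2 < t − s < 1. Let T be the first return time to 0. Then: (1) P_0[T < ∞] = 1 but E_0[T] = ∞, so the chain is null recurrent; (2) the measure π given by π(0) = 1 and π(n) = q_1⋯q_{n−1}/p_n for n ≥ 1 is invariant for the chain; and (3) π(n) = (n+1)^s / n^t, which is regularly varying of index s − t, and s − t > −1. -/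
open MeasureTheory ProbabilityTheory Filter Set Topology
open scoped ENNReal NNReal

noncomputable section

/-- `p_n = (n+1)^{-s}` (with `p_0 = 1`). -/
def pcoef (s : ℝ) (n : ℕ) : ℝ := ((n : ℝ) + 1) ^ (-s)

/-- `q_n = (n/(n+1))^t` for `n ≥ 1`, with `q_0 = 1`. -/
def qcoef (t : ℝ) (n : ℕ) : ℝ := if n = 0 then 1 else ((n : ℝ) / ((n : ℝ) + 1)) ^ t

/-- The transition matrix of Example 6.2: from `0` jump to `1`; from `i ≠ 0` go to `i+1`
with probability `p_i q_i`, to `0` with probability `p_i (1-q_i)`, stay with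
probability `1 - p_i`. -/
def Pmat (s t : ℝ) (i j : ℕ) : ℝ :=
  if i = 0 then (if j = 1 then 1 else 0)
  else (if j = i + 1 then pcoef s i * qcoef t i else 0)
    + (if j = 0 then pcoef s i * (1 - qcoef t i) else 0)
    + (if j = i then 1 - pcoef s i else 0)

/-- Coercion `ℕ∞ → ℝ≥0∞`. -/
def ennOf (e : ℕ∞) : ℝ≥0∞ := WithTop.map (Nat.cast : ℕ → ℝ≥0) e

/-- The invariant measure of Example 6.2: `π(0) = 1`, `π(n) = q_1 ⋯ q_{n-1} / p_n`. -/
def piEx (s t : ℝ) (n : ℕ) : ℝ :=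
  if n = 0 then 1 else (∏ k ∈ Finset.Icc 1 (n - 1), qcoef t k) / pcoef s n

lemma pcoef_pos (s : ℝ) (n : ℕ) : 0 < pcoef s n := by
  unfold pcoef; positivity

lemma pcoef_le_one {s : ℝ} (hs : 0 < s) (n : ℕ) : pcoef s n ≤ 1 :=
  Real.rpow_le_one_of_one_le_of_nonpos (by simp) (by linarith)

lemma qcoef_succ (t : ℝ) (n : ℕ) :
    qcoef t (n + 1) = ((n : ℝ) + 2) ^ (-t) / ((n : ℝ) + 1) ^ (-t) := by
  have h1 : (0 : ℝ) ≤ (n : ℝ) + 1 := by positivity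
  have h2 : (0 : ℝ) ≤ (n : ℝ) + 2 := by positivity
  rw [qcoef, if_neg (Nat.succ_ne_zero n), Real.rpow_neg h1, Real.rpow_neg h2]
  push_cast
  rw [show (n : ℝ) + 1 + 1 = n + 2 by ring, Real.div_rpow h1 h2]
  field_simp

lemma qcoef_pos (t : ℝ) (n : ℕ) : 0 < qcoef t n := by
  rcases n with _ | n
  · simp [qcoef]
  · rw [qcoef_succ]; positivity

lemma qcoef_le_one {t : ℝ} (ht : 0 < t) (n : ℕ) : qcoef t n ≤ 1 := by
  unfold qcoef
  split_ifs
  · exact le_rfl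
  · exact Real.rpow_le_one (by positivity) (div_le_one_of_le₀ (by simp) (by positivity)) ht.le

lemma prod_qcoef (t : ℝ) (n : ℕ) :
    ∏ k ∈ Finset.Icc 1 n, qcoef t k = ((n : ℝ) + 1) ^ (-t) := by
  induction n with
  | zero => simp
  | succ n ih =>
    rw [Finset.prod_Icc_succ_top (by omega), ih, qcoef_succ]
    have : ((n : ℝ) + 1) ^ (-t) ≠ 0 := by positivity
    push_cast
    rw [show (n : ℝ) + 1 + 1 = n + 2 by ring]
    field_simp

lemma piEx_zero (s t : ℝ) : piEx s t 0 = 1 := if_pos rfl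

lemma piEx_succ (s t : ℝ) (n : ℕ) :
    piEx s t (n + 1) = ((n : ℝ) + 1) ^ (-t) / pcoef s (n + 1) := by
  rw [piEx, if_neg (Nat.succ_ne_zero n), Nat.add_sub_cancel, prod_qcoef]

lemma piEx_eq (s t : ℝ) {n : ℕ} (hn : 1 ≤ n) :
    piEx s t n = ((n : ℝ) + 1) ^ s / (n : ℝ) ^ t := by
  obtain ⟨m, rfl⟩ := Nat.exists_eq_add_of_le' hn
  rw [piEx_succ, pcoef, Real.rpow_neg (by positivity), Real.rpow_neg (by positivity)]
  push_cast
  field_simp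

lemma tendsto_add_one_rpow_neg {t : ℝ} (ht : 0 < t) :
    Tendsto (fun n : ℕ => ((n : ℝ) + 1) ^ (-t)) atTop (𝓝 0) :=
  (tendsto_rpow_neg_atTop ht).comp
    (tendsto_atTop_add_const_right _ 1 tendsto_natCast_atTop_atTop)

lemma hasSum_piEx_mul_Pmat_zero {s t : ℝ} (ht : 0 < t) :
    HasSum (fun i : ℕ => piEx s t i * Pmat s t i 0) (piEx s t 0) := by
  have key : ∀ i : ℕ, piEx s t (i + 1) * Pmat s t (i + 1) 0
      = ((i : ℝ) + 1) ^ (-t) - (((i + 1 : ℕ) : ℝ) + 1) ^ (-t) := by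
    intro i
    have hp := (pcoef_pos s (i + 1)).ne'
    have hi : ((i : ℝ) + 1) ^ (-t) ≠ 0 := by positivity
    simp only [piEx_succ, Pmat, Nat.succ_ne_zero, if_false, if_true,
      (Nat.succ_ne_zero _).symm, qcoef_succ]
    push_cast
    rw [show (i : ℝ) + 1 + 1 = i + 2 by ring]
    field_simp
    ring
  rw [← hasSum_nat_add_iff' 1]
  simp only [key, Finset.sum_range_one, piEx_zero]
  rw [hasSum_iff_tendsto_nat_of_nonneg]
  · have := (tendsto_add_one_rpow_neg ht).const_sub 1
    simp only [Finset.sum_range_sub' (fun i : ℕ => ((i : ℝ) + 1) ^ (-t))]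
    simpa [Pmat] using this
  · intro i
    rw [sub_nonneg]
    exact Real.rpow_le_rpow_of_nonpos (by positivity) (by push_cast; linarith) (by linarith)

lemma hasSum_piEx_mul_Pmat_succ (s t : ℝ) (k : ℕ) :
    HasSum (fun i : ℕ => piEx s t i * Pmat s t i (k + 1)) (piEx s t (k + 1)) := by
  have hsupp : ∀ i ∉ ({k, k + 1} : Finset ℕ), piEx s t i * Pmat s t i (k + 1) = 0 := by
    intro i hi
    simp only [Finset.mem_insert, Finset.mem_singleton, not_or] at hi
    simp only [Pmat]
    grind
  convert hasSum_sum_of_ne_finset_zero (L := .unconditional ℕ) hsupp using 1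
  rw [Finset.sum_pair (by omega)]
  have hp' := (pcoef_pos s (k + 1)).ne'
  rcases k with _ | k
  · simp only [piEx_zero, piEx_succ, Pmat]
    simp
    field_simp
    ring
  · have hp := (pcoef_pos s (k + 1)).ne'
    have hi : ((k : ℝ) + 1) ^ (-t) ≠ 0 := by positivity
    simp only [piEx_succ, Pmat, qcoef_succ]
    simp
    rw [show (k : ℝ) + 1 + 1 = k + 2 by ring]
    field_simp
    ring

lemma hasSum_piEx_mul_Pmat {s t : ℝ} (ht : 0 < t) (j : ℕ) :
    HasSum (fun i : ℕ => piEx s t i * Pmat s t i j) (piEx s t j) := by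
  rcases j with _ | k
  · exact hasSum_piEx_mul_Pmat_zero ht
  · exact hasSum_piEx_mul_Pmat_succ s t k

lemma tendsto_piEx_ratio (s t : ℝ) {x : ℝ} (hx : 0 < x) :
    Tendsto (fun n : ℕ => piEx s t ⌊x * (n : ℝ)⌋₊ / piEx s t n) atTop (𝓝 (x ^ (s - t))) := by
  have hfl : Tendsto (fun n : ℕ => (⌊x * (n : ℝ)⌋₊ : ℝ) / n) atTop (𝓝 x) :=
    (tendsto_nat_floor_mul_div_atTop hx.le).comp tendsto_natCast_atTop_atTop
  have hinv : Tendsto (fun n : ℕ => ((n : ℝ))⁻¹) atTop (𝓝 0) :=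
    tendsto_inv_atTop_zero.comp tendsto_natCast_atTop_atTop
  have hnum : Tendsto (fun n : ℕ => ((⌊x * (n : ℝ)⌋₊ : ℝ) / n + (n : ℝ)⁻¹) / (1 + (n : ℝ)⁻¹))
      atTop (𝓝 x) := by
    have := (hfl.add hinv).div (hinv.const_add 1) (by norm_num)
    rwa [add_zero, add_zero, div_one] at this
  have hlim := (hnum.rpow_const (p := s) (Or.inl hx.ne')).div
    (hfl.rpow_const (p := t) (Or.inl hx.ne')) (by positivity)
  rw [Real.rpow_sub hx]
  refine hlim.congr' ?_
  have hfloor : ∀ᶠ n : ℕ in atTop, 1 ≤ ⌊x * (n : ℝ)⌋₊ :=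
    (tendsto_nat_floor_atTop.comp
      (tendsto_natCast_atTop_atTop.const_mul_atTop hx)).eventually_ge_atTop 1
  filter_upwards [hfloor, eventually_ge_atTop 1] with n hm hn
  rw [piEx_eq s t hm, piEx_eq s t hn]
  have hn0 : (0 : ℝ) < n := by exact_mod_cast hn
  have hm0 : (0 : ℝ) < (⌊x * (n : ℝ)⌋₊ : ℝ) := by exact_mod_cast hm
  simp only [Pi.div_apply]
  generalize (⌊x * (n : ℝ)⌋₊ : ℝ) = m at hm0
  have h1 : (m / n + (n : ℝ)⁻¹) / (1 + (n : ℝ)⁻¹) = (m + 1) / (n + 1) := by field_simp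
  rw [h1, Real.div_rpow (by positivity) (by positivity), Real.div_rpow hm0.le hn0.le]
  field_simp

/-- `survival s t n i` is the probability that the chain started at `i ≠ 0` avoids `0` during
its first `n` steps. -/
def survival (s t : ℝ) : ℕ → ℕ → ℝ
  | 0, _ => 1
  | n + 1, i => pcoef s i * qcoef t i * survival s t n (i + 1) + (1 - pcoef s i) * survival s t n i

lemma survival_nonneg {s t : ℝ} (hs : 0 < s) (n i : ℕ) : 0 ≤ survival s t n i := by
  induction n generalizing i with
  | zero => exact zero_le_one
  | succ n ih =>
    have := pcoef_pos s i
    have := qcoef_pos t i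
    have := ih i
    have := ih (i + 1)
    have := sub_nonneg.2 (pcoef_le_one hs i)
    rw [survival]
    positivity

lemma survival_succ_le {s t : ℝ} (hs : 0 < s) (ht : 0 < t) (n i : ℕ) :
    survival s t (n + 1) i ≤ survival s t n i := by
  induction n generalizing i with
  | zero =>
    have := mul_le_mul_of_nonneg_left (qcoef_le_one ht i) (pcoef_pos s i).le
    simp only [survival]
    linarith
  | succ n ih =>
    exact add_le_add
      (mul_le_mul_of_nonneg_left (ih _) (mul_pos (pcoef_pos s i) (qcoef_pos t i)).le)
      (mul_le_mul_of_nonneg_left (ih _) (sub_nonneg.2 (pcoef_le_one hs i)))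

lemma survival_antitone {s t : ℝ} (hs : 0 < s) (ht : 0 < t) (i : ℕ) :
    Antitone (fun n => survival s t n i) :=
  antitone_nat_of_succ_le fun n => survival_succ_le hs ht n i

lemma survival_le_one {s t : ℝ} (hs : 0 < s) (ht : 0 < t) (n i : ℕ) : survival s t n i ≤ 1 :=
  survival_antitone hs ht i (Nat.zero_le n)

lemma tendsto_survival {s t : ℝ} (hs : 0 < s) (ht : 0 < t) :
    Tendsto (fun n => survival s t n 1) atTop (𝓝 0) := by
  have hex : ∀ i, ∃ l, Tendsto (fun n => survival s t n i) atTop (𝓝 l) := fun i =>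
    ⟨_, tendsto_atTop_ciInf (survival_antitone hs ht i)
      ⟨0, by rintro _ ⟨n, rfl⟩; exact survival_nonneg hs n i⟩⟩
  choose l hl using hex
  have hrec : ∀ i, l i = qcoef t i * l (i + 1) := by
    intro i
    have h := tendsto_nhds_unique ((hl i).comp (tendsto_add_atTop_nat 1))
      (((hl (i + 1)).const_mul (pcoef s i * qcoef t i)).add ((hl i).const_mul (1 - pcoef s i)))
    refine mul_left_cancel₀ (pcoef_pos s i).ne' ?_
    linarith
  have hprod : ∀ k, l 1 = (∏ i ∈ Finset.Icc 1 k, qcoef t i) * l (k + 1) := by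
    intro k
    induction k with
    | zero => simp
    | succ k ih => rw [Finset.prod_Icc_succ_top (by omega), mul_assoc, ← hrec, ih]
  have hle : l 1 ≤ 0 := by
    refine ge_of_tendsto' (tendsto_add_one_rpow_neg ht) fun k => ?_
    rw [hprod k, prod_qcoef]
    exact mul_le_of_le_one_right (by positivity)
      (le_of_tendsto' (hl _) fun n => survival_le_one hs ht n _)
  have hge : 0 ≤ l 1 := ge_of_tendsto' (hl 1) fun n => survival_nonneg hs n 1
  simpa [le_antisymm hle hge] using hl 1

lemma not_summable_piEx_succ {s t : ℝ} (hs : 0 < s) (hts : t - s < 1) :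
    ¬ Summable (fun n : ℕ => piEx s t (n + 1)) := by
  rw [summable_nat_add_iff 1]
  intro h
  have h2 : Summable (fun n : ℕ => (n : ℝ) ^ (s - t)) := by
    rw [← summable_nat_add_iff 1] at h ⊢
    refine h.of_nonneg_of_le (fun n => by positivity) fun n => ?_
    rw [piEx_eq s t (by omega), Real.rpow_sub (by positivity)]
    gcongr
    linarith
  rw [Real.summable_nat_rpow] at h2
  linarith

lemma not_summable_survival {s t : ℝ} (hs : 0 < s) (hts : t - s < 1) :
    ¬ Summable (fun n => survival s t n 1) := by
  intro h
  have hsum : ∀ i, Summable (fun n => survival s t n (i + 1)) := by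
    intro i
    induction i with
    | zero => exact h
    | succ i ih =>
      have hc := mul_pos (pcoef_pos s (i + 1)) (qcoef_pos t (i + 1))
      rw [← summable_mul_left_iff hc.ne']
      refine ((summable_nat_add_iff 1).2 ih).of_nonneg_of_le
        (fun n => mul_nonneg hc.le (survival_nonneg hs n _)) fun n => ?_
      have := mul_nonneg (sub_nonneg.2 (pcoef_le_one hs (i + 1)))
        (survival_nonneg (t := t) hs n (i + 1))
      rw [survival]
      linarith
  have hrec : ∀ i, ∑' n, survival s t n (i + 1)
      = 1 / pcoef s (i + 1) + qcoef t (i + 1) * ∑' n, survival s t n (i + 2) := by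
    intro i
    have h1 := (hsum i).tsum_eq_zero_add
    simp only [survival] at h1
    rw [((hsum (i + 1)).mul_left _).tsum_add ((hsum i).mul_left _), tsum_mul_left,
      tsum_mul_left] at h1
    have hp := pcoef_pos s (i + 1)
    field_simp
    linarith
  have hpart : ∀ k, ∑' n, survival s t n 1 = ∑ i ∈ Finset.range k, piEx s t (i + 1)
      + (∏ i ∈ Finset.Icc 1 k, qcoef t i) * ∑' n, survival s t n (k + 1) := by
    intro k
    induction k with
    | zero => simp
    | succ k ih =>
      rw [ih, hrec, Finset.sum_range_succ, Finset.prod_Icc_succ_top (by omega), piEx_succ,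
        prod_qcoef]
      ring
  refine not_summable_piEx_succ hs hts (summable_of_sum_range_le
    (c := ∑' n, survival s t n 1) (fun i => ?_) fun k => ?_)
  · rw [piEx_succ]
    have := pcoef_pos s (i + 1)
    positivity
  · rw [hpart k, prod_qcoef]
    have : 0 ≤ ∑' n, survival s t n (k + 1) := tsum_nonneg fun n => survival_nonneg hs n _
    exact le_add_of_nonneg_right (by positivity)

/-- Conditionally on the first `k + 1` steps, the chain avoids `0` during the next `n` steps with
probability `survival s t n`. -/
lemma measure_cylinder_inter_avoid {s t : ℝ} (hs : 0 < s) {μ : Measure (ℕ → ℕ)} {x : ℕ}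
    (hmarkov : ∀ (k : ℕ) (j : ℕ → ℕ),
      μ {ω | ∀ i ≤ k, ω (i + 1) = j i}
        = ENNReal.ofReal (∏ i ∈ Finset.range (k + 1),
            Pmat s t (if i = 0 then x else j (i - 1)) (j i)))
    (n k : ℕ) (j : ℕ → ℕ) (hj : j k ≠ 0) :
    μ {ω | (∀ i ≤ k, ω (i + 1) = j i) ∧ ∀ m < n, ω (k + 2 + m) ≠ 0}
      = μ {ω | ∀ i ≤ k, ω (i + 1) = j i} * ENNReal.ofReal (survival s t n (j k)) := by
  induction n generalizing k j with
  | zero => simp [survival]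
  | succ n ih =>
    have hPnonneg : ∀ v, v ≠ 0 → 0 ≤ Pmat s t (j k) v := by
      intro v hv
      have := mul_pos (pcoef_pos s (j k)) (qcoef_pos t (j k))
      have := pcoef_le_one hs (j k)
      simp only [Pmat, if_neg hj, if_neg hv]
      split_ifs <;> linarith
    have hstep : ∀ v, v ≠ 0 →
        μ {ω | ∀ i ≤ k + 1, ω (i + 1) = Function.update j (k + 1) v i}
          = μ {ω | ∀ i ≤ k, ω (i + 1) = j i} * ENNReal.ofReal (Pmat s t (j k) v) := by
      intro v hv
      rw [hmarkov, hmarkov, ← ENNReal.ofReal_mul' (hPnonneg v hv), Finset.prod_range_succ]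
      congr 2
      · refine Finset.prod_congr rfl fun i hi => ?_
        have hi := Finset.mem_range.1 hi
        rw [Function.update_of_ne (by omega), Function.update_of_ne (by omega)]
      · simp
    have hpre : ∀ v, μ ({ω | (∀ i ≤ k, ω (i + 1) = j i) ∧ ∀ m < n + 1, ω (k + 2 + m) ≠ 0}
          ∩ (fun ω : ℕ → ℕ => ω (k + 2)) ⁻¹' {v})
        = if v = 0 then 0 else μ {ω | ∀ i ≤ k, ω (i + 1) = j i} *
            (ENNReal.ofReal (Pmat s t (j k) v) * ENNReal.ofReal (survival s t n v)) := by
      intro v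
      split_ifs with hv
      · convert measure_empty (μ := μ)
        ext ω
        simp only [mem_inter_iff, mem_ofPred_eq, mem_preimage, mem_singleton_iff,
          mem_empty_iff_false, iff_false]
        rintro ⟨⟨-, h⟩, h'⟩
        exact h 0 (by omega) (h'.trans hv)
      · have hi := ih (k + 1) (Function.update j (k + 1) v) (by simpa using hv)
        rw [hstep v hv, Function.update_self, mul_assoc] at hi
        rw [← hi]
        congr 1
        ext ω
        simp only [mem_inter_iff, mem_ofPred_eq, mem_preimage, mem_singleton_iff]
        constructor
        · rintro ⟨⟨h1, h2⟩, h3⟩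
          refine ⟨fun i hik => ?_, fun m hm => ?_⟩
          · rcases Nat.lt_or_ge k i with h | h
            · obtain rfl : i = k + 1 := by omega
              simpa using h3
            · rw [Function.update_of_ne (by omega)]
              exact h1 i h
          · have := h2 (m + 1) (by omega)
            rwa [show k + 2 + (m + 1) = k + 1 + 2 + m by ring] at this
        · rintro ⟨h1, h2⟩
          have h3 : ω (k + 2) = v := by simpa using h1 (k + 1) le_rfl
          refine ⟨⟨fun i hik => ?_, fun m hm => ?_⟩, h3⟩
          · have := h1 i (by omega)
            rwa [Function.update_of_ne (by omega)] at this
          · rcases m with _ | m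
            · simpa [h3] using hv
            · have := h2 m (by omega)
              rwa [show k + 1 + 2 + m = k + 2 + (m + 1) by ring] at this
    have hmeas : ∀ v : ℕ, MeasurableSet ((fun ω : ℕ → ℕ => ω (k + 2)) ⁻¹' {v}) := fun v =>
      measurable_pi_apply (k + 2) (measurableSet_singleton v)
    have htot : μ {ω | (∀ i ≤ k, ω (i + 1) = j i) ∧ ∀ m < n + 1, ω (k + 2 + m) ≠ 0}
        = ∑' v, μ ({ω | (∀ i ≤ k, ω (i + 1) = j i) ∧ ∀ m < n + 1, ω (k + 2 + m) ≠ 0}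
          ∩ (fun ω : ℕ → ℕ => ω (k + 2)) ⁻¹' {v}) := by
      rw [← Measure.restrict_apply_univ, ← preimage_univ (f := fun ω : ℕ → ℕ => ω (k + 2)),
        ← tsum_measure_preimage_singleton countable_univ fun v _ => hmeas v,
        tsum_univ fun v => (μ.restrict _) ((fun ω : ℕ → ℕ => ω (k + 2)) ⁻¹' {v})]
      exact tsum_congr fun v => by rw [Measure.restrict_apply (hmeas v), inter_comm]
    rw [htot]
    simp only [hpre]
    rw [tsum_eq_sum (s := {j k + 1, j k}), Finset.sum_pair (by omega), if_neg (by omega),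
      if_neg hj, ← mul_add, ← ENNReal.ofReal_mul (hPnonneg _ (by omega)),
      ← ENNReal.ofReal_mul (hPnonneg _ hj), ← ENNReal.ofReal_add]
    · simp [survival, Pmat, hj]
    · exact mul_nonneg (hPnonneg _ (by omega)) (survival_nonneg hs _ _)
    · exact mul_nonneg (hPnonneg _ hj) (survival_nonneg hs _ _)
    · intro v hv
      simp only [Finset.mem_insert, Finset.mem_singleton, not_or] at hv
      by_cases hv0 : v = 0 <;> simp [Pmat, hj, hv0, hv.1, hv.2]

lemma lt_hitT_iff {E : Type*} (a : Set E) (ω : ℕ → E) (n : ℕ) :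
    (n : ℕ∞) < hitT a ω ↔ ∀ m < n, ω (m + 1) ∉ a := by
  constructor
  · intro h m hm hmem
    have : hitT a ω ≤ ((m + 1 : ℕ) : ℕ∞) := iInf₂_le (m + 1) ⟨by omega, hmem⟩
    have := h.trans_le this
    rw [Nat.cast_lt] at this
    omega
  · intro h
    refine (Nat.cast_lt.2 n.lt_succ_self).trans_le (le_iInf₂ fun i hi => Nat.cast_le.2 ?_)
    by_contra! hlt
    refine h (i - 1) (by omega) ?_
    rw [Nat.sub_add_cancel hi.1]
    exact hi.2

lemma measurableSet_lt_hitT {E : Type*} [MeasurableSpace E] {a : Set E} (ha : MeasurableSet a)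
    (n : ℕ) : MeasurableSet {ω : ℕ → E | (n : ℕ∞) < hitT a ω} := by
  simp only [lt_hitT_iff, ofPred_forall]
  exact .iInter fun m => .iInter fun _ => (measurable_pi_apply (m + 1) ha).compl

lemma tsum_indicator_lt_hitT_le {E : Type*} (a : Set E) (ω : ℕ → E) :
    ∑' n : ℕ, {ω : ℕ → E | ((n + 1 : ℕ) : ℕ∞) < hitT a ω}.indicator (1 : (ℕ → E) → ℝ≥0∞) ω
      ≤ ennOf (hitT a ω) := by
  simp only [indicator_apply, mem_ofPred_eq, Pi.one_apply]
  generalize hitT a ω = T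
  induction T with
  | top => exact le_top
  | coe N =>
    rw [tsum_eq_sum (s := Finset.range N)]
    · calc ∑ n ∈ Finset.range N, (if ((n + 1 : ℕ) : ℕ∞) < (N : ℕ∞) then 1 else 0 : ℝ≥0∞)
          ≤ ∑ n ∈ Finset.range N, 1 := Finset.sum_le_sum fun n _ => by split_ifs <;> simp
        _ = ennOf N := by simp; rfl
    · intro n hn
      rw [Finset.mem_range, not_lt] at hn
      rw [if_neg]
      rw [Nat.cast_lt]
      omega

lemma measure_succ_lt_hitT {s t : ℝ} (hs : 0 < s) {μ : Measure (ℕ → ℕ)} [IsProbabilityMeasure μ]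
    (hmarkov : ∀ (k : ℕ) (j : ℕ → ℕ),
      μ {ω | ∀ i ≤ k, ω (i + 1) = j i}
        = ENNReal.ofReal (∏ i ∈ Finset.range (k + 1),
            Pmat s t (if i = 0 then 0 else j (i - 1)) (j i))) (n : ℕ) :
    μ {ω | ((n + 1 : ℕ) : ℕ∞) < hitT ({0} : Set ℕ) ω} = ENNReal.ofReal (survival s t n 1) := by
  have hone : μ {ω | ∀ i ≤ 0, ω (i + 1) = 1} = 1 := by
    simpa [Pmat] using hmarkov 0 fun _ => 1
  have h := measure_cylinder_inter_avoid hs hmarkov n 0 (fun _ => 1) one_ne_zero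
  rw [hone, one_mul] at h
  have hae : ∀ᵐ ω ∂μ, ω 1 = 1 := by
    have hmeas : MeasurableSet {ω : ℕ → ℕ | ω 1 = 1} :=
      measurable_pi_apply 1 (measurableSet_singleton 1)
    refine (mem_ae_iff_prob_eq_one hmeas).2 ?_
    simpa using hone
  rw [← h]
  refine measure_congr ?_
  filter_upwards [hae] with ω hω
  refine propext ?_
  change ((n + 1 : ℕ) : ℕ∞) < hitT ({0} : Set ℕ) ω ↔
    (∀ i ≤ 0, ω (i + 1) = 1) ∧ ∀ m < n, ω (0 + 2 + m) ≠ 0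
  rw [lt_hitT_iff]
  constructor
  · refine fun havoid => ⟨fun i hi => ?_, fun m hm => ?_⟩
    · obtain rfl : i = 0 := by omega
      exact hω
    · have := havoid (m + 1) (by omega)
      rwa [show m + 1 + 1 = 0 + 2 + m by ring] at this
  · rintro ⟨-, havoid⟩ m hm
    rcases m with _ | m
    · simp [hω]
    · have := havoid m (by omega)
      rwa [show 0 + 2 + m = m + 1 + 1 by ring] at this

lemma measure_hitT_lt_top {s t : ℝ} (hs : 0 < s) (ht : 0 < t) {μ : Measure (ℕ → ℕ)}
    [IsProbabilityMeasure μ]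
    (hμ : ∀ n : ℕ, μ {ω | ((n + 1 : ℕ) : ℕ∞) < hitT ({0} : Set ℕ) ω}
      = ENNReal.ofReal (survival s t n 1)) :
    μ {ω | hitT ({0} : Set ℕ) ω < ⊤} = 1 := by
  have hzero : μ {ω | hitT ({0} : Set ℕ) ω < ⊤}ᶜ = 0 := by
    refine le_antisymm (ge_of_tendsto' (x := atTop)
      (f := fun n => ENNReal.ofReal (survival s t n 1)) ?_ fun n => ?_) zero_le
    · simpa using ENNReal.tendsto_ofReal (tendsto_survival hs ht)
    · rw [← hμ n]
      refine measure_mono fun ω hω => ?_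
      simp only [mem_compl_iff, mem_ofPred_eq, not_lt, top_le_iff] at hω
      simp only [mem_ofPred_eq, hω]
      exact ENat.natCast_lt_top _
  rw [measure_congr (eventuallyEq_univ.2 hzero), measure_univ]

lemma lintegral_hitT_eq_top {s t : ℝ} (hs : 0 < s) (hts : t - s < 1) {μ : Measure (ℕ → ℕ)}
    (hμ : ∀ n : ℕ, μ {ω | ((n + 1 : ℕ) : ℕ∞) < hitT ({0} : Set ℕ) ω}
      = ENNReal.ofReal (survival s t n 1)) :
    ∫⁻ ω, ennOf (hitT ({0} : Set ℕ) ω) ∂μ = ⊤ := by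
  have hmeas : ∀ n : ℕ, MeasurableSet {ω : ℕ → ℕ | ((n + 1 : ℕ) : ℕ∞) < hitT ({0} : Set ℕ) ω} :=
    fun n => measurableSet_lt_hitT (measurableSet_singleton 0) (n + 1)
  have hle : ∑' n, ENNReal.ofReal (survival s t n 1)
      ≤ ∫⁻ ω, ennOf (hitT ({0} : Set ℕ) ω) ∂μ := by
    simp only [← hμ, ← lintegral_indicator_one (hmeas _)]
    rw [← lintegral_tsum fun n => (measurable_one.indicator (hmeas n)).aemeasurable]
    exact lintegral_mono fun ω => tsum_indicator_lt_hitT_le _ ω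
  by_contra h
  refine not_summable_survival hs hts ?_
  simpa only [ENNReal.toReal_ofReal (survival_nonneg hs _ _)] using
    ENNReal.summable_toReal (ne_top_of_le_ne_top h hle)

/-- **Example 6.2: null recurrence and the invariant measure.** -/
theorem example62_null_recurrent_invariant
    (s t : ℝ) (hs : 0 < s) (ht : 0 < t) (hts1 : 1 / 2 < t - s) (hts2 : t - s < 1)
    /- the laws `P_x` of the chain started at `x` -/
    (Pm : ℕ → Measure (ℕ → ℕ)) (hPmProb : ∀ x, IsProbabilityMeasure (Pm x))
    (hstart : ∀ x, Pm x {ω | ω 0 = x} = 1)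
    (hmarkov : ∀ (x k : ℕ) (j : ℕ → ℕ),
      Pm x {ω | ∀ i ≤ k, ω (i + 1) = j i}
        = ENNReal.ofReal (∏ i ∈ Finset.range (k + 1),
            Pmat s t (if i = 0 then x else j (i - 1)) (j i))) :
    /- (1) the chain is null recurrent: `P_0[T < ∞] = 1` but `E_0[T] = ∞` -/
    (Pm 0 {ω | hitT ({0} : Set ℕ) ω < ⊤} = 1) ∧
    ((∫⁻ ω, ennOf (hitT ({0} : Set ℕ) ω) ∂(Pm 0)) = ⊤) ∧
    /- (2) `π` is invariant: `π P = π` -/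
    (∀ j : ℕ, Summable (fun i : ℕ => piEx s t i * Pmat s t i j) ∧
      (∑' i : ℕ, piEx s t i * Pmat s t i j) = piEx s t j) ∧
    /- (3) `π(n) = (n+1)^s / n^t`, regularly varying of index `s - t > -1` -/
    (∀ n : ℕ, 1 ≤ n → piEx s t n = ((n : ℝ) + 1) ^ s / (n : ℝ) ^ t) ∧
    (∀ x : ℝ, 0 < x → Tendsto
      (fun n : ℕ => piEx s t ⌊x * (n : ℝ)⌋₊ / piEx s t n) atTop (nhds (x ^ (s - t)))) ∧
    (-1 < s - t) := by
  have := hPmProb 0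
  have hsurv := measure_succ_lt_hitT hs (hmarkov 0)
  exact ⟨measure_hitT_lt_top hs ht hsurv, lintegral_hitT_eq_top hs hts2 hsurv,
    fun j => ⟨(hasSum_piEx_mul_Pmat ht j).summable, (hasSum_piEx_mul_Pmat ht j).tsum_eq⟩,
    fun n hn => piEx_eq s t hn, fun x hx => tendsto_piEx_ratio s t hx, by linarith⟩
end
end
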